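/- Let A=(C,m) be a 3-dimensional toric idealistic cluster and let Q_i, Q_j be nodes with Q_j proximate to Q_i, χ_i = χ_j = 0 and ν_i·N_j = ν_j·N_i. Write ν_i/N_i = a/b with a, b coprime positive integers, and suppose −a/b is a pole of the local topological zeta function Z(s) of A of order at least 2. Then b = 1 or Σ_{k: 1 ≤ k ≤ r, b | N_k} χ_k ≠ 0. -/

import Mathlib

open Finset

/-!
Common framework: 3-dimensional toric constellations and toric idealistic clusters.
The edge labels `1, 2, 3` of the paper are encoded as `0, 1, 2 : Fin 3`.
-/

/-- A 3-dimensional toric constellation: a finite rooted tree on nodes `0, …, r−1`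
(node `0` the root, every child having larger index than its parent), each node having
at most three children, the edges from a node to its children carrying pairwise
distinct labels in `Fin 3`.  `label j` is the label of the edge from `parent j` to `j`
(irrelevant for the root). -/
structure ToricConstellation (r : ℕ) where
  parent : Fin r → Fin r
  label : Fin r → Fin 3
  parent_lt : ∀ i : Fin r, 0 < (i : ℕ) → (parent i : ℕ) < (i : ℕ)
  parent_root : ∀ i : Fin r, (i : ℕ) = 0 → parent i = i
  label_distinct : ∀ i j : Fin r, 0 < (i : ℕ) → 0 < (j : ℕ) → i ≠ j →
    parent i = parent j → label i ≠ label j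

namespace ToricConstellation

variable {r : ℕ}

/-- The ordered triple of vectors of `ℤ³` attached to a node: the root carries the
standard basis, and the child along the edge labelled `a` of a node with cone
`(u₁,u₂,u₃)` carries the triple obtained by replacing `u_a` with `u₁+u₂+u₃`. -/
def cone (C : ToricConstellation r) (i : Fin r) : Fin 3 → (Fin 3 → ℤ) :=
  if h : 0 < (i : ℕ) then
    Function.update (cone C (C.parent i)) (C.label i) (∑ a, cone C (C.parent i) a)
  else fun a => Pi.single a 1
termination_by (i : ℕ)
decreasing_by all_goals exact C.parent_lt i h

/-- `v(Q) = u₁ + u₂ + u₃`, the sum of the cone vectors of a node. -/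
def v (C : ToricConstellation r) (i : Fin r) : Fin 3 → ℤ := ∑ a, cone C i a

/-- `Prox C j i` means `j → i`, i.e. `Q_j` is proximate to `Q_i`:
`j ≠ i` and `v(Q_i)` is an entry of `cone(Q_j)`. -/
def Prox (C : ToricConstellation r) (j i : Fin r) : Prop :=
  j ≠ i ∧ ∃ a : Fin 3, cone C j a = v C i

instance (C : ToricConstellation r) (j i : Fin r) : Decidable (C.Prox j i) := by
  unfold Prox; infer_instance

/-- `inChain C i a b j = true` iff `j = Q_i(a, b^t)` for some `t ≥ 0`, i.e. `j` is
reached from `i` by one edge labelled `a` followed by `t` edges labelled `b`. -/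
def inChain (C : ToricConstellation r) (i : Fin r) (a b : Fin 3) (j : Fin r) : Bool :=
  if h : 0 < (j : ℕ) then
    (decide (C.parent j = i) && decide (C.label j = a)) ||
      (decide (C.label j = b) && inChain C i a b (C.parent j))
  else false
termination_by (j : ℕ)
decreasing_by exact C.parent_lt j h

/-- `LinProx C j i` means `j ↠ i`, i.e. `Q_j` is linearly proximate to `Q_i`. -/
def LinProx (C : ToricConstellation r) (j i : Fin r) : Prop :=
  ∃ a b : Fin 3, a ≠ b ∧ inChain C i a b j = true

instance (C : ToricConstellation r) (j i : Fin r) : Decidable (C.LinProx j i) := by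
  unfold LinProx; infer_instance

/-- `j` is a child of `i`. -/
def IsChild (C : ToricConstellation r) (j i : Fin r) : Prop :=
  0 < (j : ℕ) ∧ C.parent j = i

instance (C : ToricConstellation r) (j i : Fin r) : Decidable (C.IsChild j i) := by
  unfold IsChild; infer_instance

/-- The set `S_i` of labels of the edges on the path from the root to `Q_i`. -/
def labelsUnder (C : ToricConstellation r) (i : Fin r) : Finset (Fin 3) :=
  if h : 0 < (i : ℕ) then insert (C.label i) (labelsUnder C (C.parent i)) else ∅
termination_by (i : ℕ)
decreasing_by exact C.parent_lt i h

/-- `i` is a weak ancestor of `j` (`i = j` or `i` a strict ancestor of `j`). -/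
def anc (C : ToricConstellation r) (i j : Fin r) : Bool :=
  decide (i = j) || (if h : 0 < (j : ℕ) then anc C i (C.parent j) else false)
termination_by (j : ℕ)
decreasing_by exact C.parent_lt j h

/-- The set of nodes weakly above `i` (`i` together with its descendants). -/
def weakAbove (C : ToricConstellation r) (i : Fin r) : Finset (Fin r) :=
  univ.filter (fun j => anc C i j = true)

end ToricConstellation

/-- A 3-dimensional toric cluster: a toric constellation together with a positive
integer weight for each node. -/
structure ToricCluster (r : ℕ) extends ToricConstellation r where
  m : Fin r → ℤ
  m_pos : ∀ j, 0 < m j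

namespace ToricCluster

open ToricConstellation

variable {r : ℕ}

/-- `M_{Q_i}(a,b) := Σ_{t ≥ 0, Q_i(a,b^t) ∈ C} m_{Q_i(a,b^t)}`. -/
def M (A : ToricCluster r) (i : Fin r) (a b : Fin 3) : ℤ :=
  ∑ j ∈ univ.filter (fun j => inChain A.toToricConstellation i a b j = true), A.m j

/-- The cluster is idealistic: the linear proximity inequalities
`M_{Q_i}(a,b) + M_{Q_i}(b,a) ≤ m_{Q_i}` hold. -/
def Idealistic (A : ToricCluster r) : Prop :=
  ∀ i : Fin r, ∀ a b : Fin 3, a ≠ b → A.M i a b + A.M i b a ≤ A.m i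

/-- The set of nodes `j` proximate to `i` (`j → i`). -/
def proxSet (A : ToricCluster r) (i : Fin r) : Finset (Fin r) :=
  univ.filter (fun j => Prox A.toToricConstellation j i)

/-- `B_i`: the set of nodes to which `i` is proximate. -/
def Bset (A : ToricCluster r) (i : Fin r) : Finset (Fin r) :=
  univ.filter (fun j => Prox A.toToricConstellation i j)

/-- `A_i`: the children `k` of `i` for which there is no `l` with `i → l` and `k → l`. -/
def Aset (A : ToricCluster r) (i : Fin r) : Finset (Fin r) :=
  univ.filter (fun k => IsChild A.toToricConstellation k i ∧
    ¬ ∃ l, Prox A.toToricConstellation i l ∧ Prox A.toToricConstellation k l)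

/-- The Euler characteristic `χ_i = χ(E_i°)`. -/
def chi (A : ToricCluster r) (i : Fin r) : ℤ :=
  3 + A.m i * (A.m i - 3)
    - ∑ j ∈ A.proxSet i, A.m j * (A.m j - 1)
    + ∑ j ∈ A.proxSet i,
        (A.m j - ∑ k ∈ (A.proxSet i).filter
          (fun k => LinProx A.toToricConstellation k j), A.m k)
    + ∑ j ∈ A.Bset i,
        (A.m i - ∑ k ∈ (A.proxSet j).filter
          (fun k => LinProx A.toToricConstellation k i), A.m k)
    - ((A.Aset i).card : ℤ) - 2 * ((A.Bset i).card : ℤ)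
    + (((A.Bset i).card.choose 2 : ℕ) : ℤ)

/-- `D_i = m_i² − Σ_{j→i} m_j²`. -/
def D (A : ToricCluster r) (i : Fin r) : ℤ :=
  A.m i ^ 2 - ∑ j ∈ A.proxSet i, A.m j ^ 2

/-- `r_{ab} = m_i − M_{Q_i}(a,b) − M_{Q_i}(b,a)`. -/
def rab (A : ToricCluster r) (i : Fin r) (a b : Fin 3) : ℤ :=
  A.m i - A.M i a b - A.M i b a

/-- `R_i = r̂_{12} + r̂_{13} + r̂_{23}`, where `r̂_{ab} = r_{ab}` if the remaining third
label does not appear under `Q_i`, and `r̂_{ab} = 0` otherwise.  (Labels `1,2,3` are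
encoded as `0,1,2 : Fin 3`.) -/
def R (A : ToricCluster r) (i : Fin r) : ℤ :=
  (if (2 : Fin 3) ∉ labelsUnder A.toToricConstellation i then A.rab i 0 1 else 0)
  + (if (1 : Fin 3) ∉ labelsUnder A.toToricConstellation i then A.rab i 0 2 else 0)
  + (if (0 : Fin 3) ∉ labelsUnder A.toToricConstellation i then A.rab i 1 2 else 0)

/-- `T_i = 3 − #A_i − 2·#B_i + (#B_i choose 2)`. -/
def T (A : ToricCluster r) (i : Fin r) : ℤ :=
  3 - ((A.Aset i).card : ℤ) - 2 * ((A.Bset i).card : ℤ)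
    + (((A.Bset i).card.choose 2 : ℕ) : ℤ)

/-- The nodes to which `i` is proximate, of smaller index: the sums in the recursive
definitions of the numerical data range over the nodes to which `i` is proximate,
which are ancestors of `i` and hence have smaller index (making the recursion
well-founded). -/
def anteSet (A : ToricCluster r) (i : Fin r) : Finset (Fin r) :=
  univ.filter (fun j => (j : ℕ) < (i : ℕ) ∧ Prox A.toToricConstellation i j)

/-- The numerical datum `N_i := m_i + Σ_{j : i→j} N_j`. -/
def N (A : ToricCluster r) (i : Fin r) : ℤ :=
  A.m i + ∑ j ∈ (A.anteSet i).attach, N A j.1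
termination_by (i : ℕ)
decreasing_by
  have hj := j.2
  simp only [anteSet, Finset.mem_filter] at hj
  exact hj.2.1

/-- The numerical datum `ν_i := 3 + Σ_{j : i→j} (ν_j − 1)`. -/
def nu (A : ToricCluster r) (i : Fin r) : ℤ :=
  3 + ∑ j ∈ (A.anteSet i).attach, (nu A j.1 - 1)
termination_by (i : ℕ)
decreasing_by
  have hj := j.2
  simp only [anteSet, Finset.mem_filter] at hj
  exact hj.2.1

end ToricCluster

namespace ToricCluster

open ToricConstellation

variable {r : ℕ}

/-- `χ_{0,i}`. -/
def chi0 (A : ToricCluster r) (i : Fin r) : ℤ :=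
  A.m i * (3 - A.m i) + ∑ j ∈ A.proxSet i, A.m j * (A.m j - 1)
    - ∑ j ∈ A.proxSet i,
        (A.m j - ∑ k ∈ (A.proxSet i).filter
          (fun k => LinProx A.toToricConstellation k j), A.m k)
    - ∑ j ∈ A.Bset i,
        (A.m i - ∑ k ∈ (A.proxSet j).filter
          (fun k => LinProx A.toToricConstellation k i), A.m k)

/-- `χ_{0,i,j} = m_j − Σ_{k: k→i, k↠j} m_k`, for `j → i`. -/
def chi0pair (A : ToricCluster r) (i j : Fin r) : ℤ :=
  A.m j - ∑ k ∈ (A.proxSet i).filter (fun k => LinProx A.toToricConstellation k j), A.m k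

/-- `A_{ij}`: the children `k` of `j` with `k → i`. -/
def Apair (A : ToricCluster r) (i j : Fin r) : Finset (Fin r) :=
  univ.filter (fun k => IsChild A.toToricConstellation k j ∧ Prox A.toToricConstellation k i)

/-- `B_{ij} = {k ≠ i : j → k}`. -/
def Bpair (A : ToricCluster r) (i j : Fin r) : Finset (Fin r) :=
  univ.filter (fun k => k ≠ i ∧ Prox A.toToricConstellation j k)

/-- `C_{ij}`: children `k` of `j` with `k → i` such that there is `l ≠ i` with
`k → l` and `j → l`. -/
def Cpair (A : ToricCluster r) (i j : Fin r) : Finset (Fin r) :=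
  univ.filter (fun k => IsChild A.toToricConstellation k j ∧ Prox A.toToricConstellation k i ∧
    ∃ l, l ≠ i ∧ Prox A.toToricConstellation k l ∧ Prox A.toToricConstellation j l)

/-- `χ_{i,j}`, for `j → i`. -/
def chipair (A : ToricCluster r) (i j : Fin r) : ℤ :=
  2 - A.chi0pair i j - ((A.Apair i j).card : ℤ) - ((A.Bpair i j).card : ℤ)
    + ((A.Cpair i j).card : ℤ)

/-- `χ_{i,j,k} = 1 − #{l : l→i, l→j, l→k}`, for `i < j < k`, `k → i`, `k → j`. -/
def chitriple (A : ToricCluster r) (i j k : Fin r) : ℤ :=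
  1 - ((univ.filter (fun l => Prox A.toToricConstellation l i ∧
        Prox A.toToricConstellation l j ∧ Prox A.toToricConstellation l k)).card : ℤ)

/-- The linear factor `N_i·s + ν_i`, as a rational function in `s`. -/
noncomputable def lin (A : ToricCluster r) (i : Fin r) : RatFunc ℚ :=
  (A.N i : RatFunc ℚ) * RatFunc.X + (A.nu i : RatFunc ℚ)

/-- The local topological zeta function of the cluster, as a rational function over `ℚ`:
`Z(s) = Σ_i [χ_i/(N_i s+ν_i) + χ_{0,i}/((s+1)(N_i s+ν_i))]
  + Σ_{j→i} [χ_{i,j}/((N_i s+ν_i)(N_j s+ν_j)) + χ_{0,i,j}/((s+1)(N_i s+ν_i)(N_j s+ν_j))]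
  + Σ_{i<j<k, k→i, k→j} χ_{i,j,k}/((N_i s+ν_i)(N_j s+ν_j)(N_k s+ν_k))`. -/
noncomputable def Zeta (A : ToricCluster r) : RatFunc ℚ :=
  (∑ i : Fin r,
      ((A.chi i : RatFunc ℚ) / A.lin i
        + (A.chi0 i : RatFunc ℚ) / ((RatFunc.X + 1) * A.lin i)))
  + (∑ p ∈ (univ ×ˢ univ).filter
        (fun p : Fin r × Fin r => Prox A.toToricConstellation p.2 p.1),
      ((A.chipair p.1 p.2 : RatFunc ℚ) / (A.lin p.1 * A.lin p.2)
        + (A.chi0pair p.1 p.2 : RatFunc ℚ) / ((RatFunc.X + 1) * (A.lin p.1 * A.lin p.2))))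
  + (∑ t ∈ (univ : Finset (Fin r × Fin r × Fin r)).filter
        (fun t => t.1 < t.2.1 ∧ t.2.1 < t.2.2 ∧ Prox A.toToricConstellation t.2.2 t.1
          ∧ Prox A.toToricConstellation t.2.2 t.2.1),
      (A.chitriple t.1 t.2.1 t.2.2 : RatFunc ℚ) / (A.lin t.1 * A.lin t.2.1 * A.lin t.2.2))

/-- The rational function `Z^{(r)}(s)` (here the positive integer is called `d`):
the same sum as `Z(s)`, keeping only the terms not containing the factor `(s+1)` and in
which every occurring index `i` satisfies `d ∣ N_i`. -/
noncomputable def ZetaR (A : ToricCluster r) (d : ℕ) : RatFunc ℚ :=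
  (∑ i ∈ univ.filter (fun i : Fin r => (d : ℤ) ∣ A.N i),
      (A.chi i : RatFunc ℚ) / A.lin i)
  + (∑ p ∈ (univ ×ˢ univ).filter
        (fun p : Fin r × Fin r => Prox A.toToricConstellation p.2 p.1
          ∧ (d : ℤ) ∣ A.N p.1 ∧ (d : ℤ) ∣ A.N p.2),
      (A.chipair p.1 p.2 : RatFunc ℚ) / (A.lin p.1 * A.lin p.2))
  + (∑ t ∈ (univ : Finset (Fin r × Fin r × Fin r)).filter
        (fun t => t.1 < t.2.1 ∧ t.2.1 < t.2.2 ∧ Prox A.toToricConstellation t.2.2 t.1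
          ∧ Prox A.toToricConstellation t.2.2 t.2.1
          ∧ (d : ℤ) ∣ A.N t.1 ∧ (d : ℤ) ∣ A.N t.2.1 ∧ (d : ℤ) ∣ A.N t.2.2),
      (A.chitriple t.1 t.2.1 t.2.2 : RatFunc ℚ) / (A.lin t.1 * A.lin t.2.1 * A.lin t.2.2))

end ToricCluster

namespace ToricConstellation

variable {r : ℕ} (C : ToricConstellation r)

open Classical in
/-- The child of `i` along the edge labelled `x`, if there is one. -/
noncomputable def ch (i : Fin r) (x : Fin 3) : Option (Fin r) :=
  if h : ∃ k : Fin r, 0 < (k : ℕ) ∧ C.parent k = i ∧ C.label k = x then some h.choose else none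

/-- The node whose vector `v` is the entry number `a` of the cone of a node (`none` if that
entry is a standard basis vector). -/
def slot (j : Fin r) : Fin 3 → Option (Fin r) :=
  if h : 0 < (j : ℕ) then
    Function.update (slot (C.parent j)) (C.label j) (some (C.parent j))
  else fun _ => none
termination_by (j : ℕ)
decreasing_by exact C.parent_lt j h

/-- `j` is reached from `n` by a path whose edge labels all belong to `s`. -/
def Desc (s : Finset (Fin 3)) : Fin r → Fin r → Prop :=
  Relation.ReflTransGen fun p q => 0 < (q : ℕ) ∧ C.parent q = p ∧ C.label q ∈ s

open Classical in
/-- The sum of `g` over the nodes reached from a (possibly missing) node by paths with labels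
in `s`. -/
noncomputable def descSum {M : Type*} [AddCommMonoid M] (s : Finset (Fin 3)) (g : Fin r → M) :
    Option (Fin r) → M
  | none => 0
  | some n => ∑ j with C.Desc s n j, g j

variable {C}

theorem ch_eq_some {i k : Fin r} {x : Fin 3} :
    C.ch i x = some k ↔ 0 < (k : ℕ) ∧ C.parent k = i ∧ C.label k = x := by
  unfold ch
  split_ifs with h
  · simp only [Option.some.injEq]
    constructor
    · rintro rfl
      exact h.choose_spec
    · rintro ⟨h1, h2, h3⟩
      by_contra hne
      exact C.label_distinct _ _ h.choose_spec.1 h1 hne (h.choose_spec.2.1.trans h2.symm)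
        (h.choose_spec.2.2.trans h3.symm)
  · simp only [false_iff]
    exact fun hk => h ⟨k, hk⟩

theorem lt_of_ch {i k : Fin r} {x : Fin 3} (h : C.ch i x = some k) : i < k := by
  obtain ⟨h1, rfl, -⟩ := ch_eq_some.1 h
  exact C.parent_lt k h1

theorem ch_parent {k : Fin r} (h : 0 < (k : ℕ)) : C.ch (C.parent k) (C.label k) = some k :=
  ch_eq_some.2 ⟨h, rfl, rfl⟩

/-- Induction from the leaves of the tree towards the root. -/
theorem ch_induction {P : Fin r → Prop} (h : ∀ n, (∀ x k, C.ch n x = some k → P k) → P n)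
    (n : Fin r) : P n := by
  induction hk : r - (n : ℕ) using Nat.strong_induction_on generalizing n with
  | _ t ih =>
    refine h n fun x k hx => ih (r - k) ?_ k rfl
    have := lt_of_ch hx
    have h1 : (n : ℕ) < k := this
    have h2 := k.isLt
    omega

/-- Induction from the root, every other node being a child of a smaller one. -/
theorem root_induction {P : Fin r → Prop} (h0 : ∀ n : Fin r, (n : ℕ) = 0 → P n)
    (h : ∀ p x k, C.ch p x = some k → P p → P k) (n : Fin r) : P n := by
  induction hk : (n : ℕ) using Nat.strong_induction_on generalizing n with
  | _ t ih =>
    by_cases hn : 0 < (n : ℕ)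
    · exact h _ _ n (ch_parent hn) (ih _ (hk ▸ C.parent_lt n hn) _ rfl)
    · exact h0 n (by omega)

theorem slot_root {n : Fin r} (h : (n : ℕ) = 0) (a : Fin 3) : C.slot n a = none := by
  rw [slot, dif_neg (by omega)]

theorem slot_ch {p k : Fin r} {x : Fin 3} (h : C.ch p x = some k) :
    C.slot k = Function.update (C.slot p) x (some p) := by
  obtain ⟨h1, rfl, rfl⟩ := ch_eq_some.1 h
  rw [slot, dif_pos h1]

theorem slot_ch_self {p k : Fin r} {x : Fin 3} (h : C.ch p x = some k) :
    C.slot k x = some p := by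
  rw [slot_ch h, Function.update_self]

theorem slot_ch_of_ne {p k : Fin r} {x y : Fin 3} (h : C.ch p x = some k) (hy : y ≠ x) :
    C.slot k y = C.slot p y := by
  rw [slot_ch h, Function.update_of_ne hy]

theorem slot_lt {j i : Fin r} {a : Fin 3} (h : C.slot j a = some i) : i < j := by
  induction j using root_induction (C := C) with
  | h0 n hn => simp [slot_root hn] at h
  | h p x k hk ih =>
    rcases eq_or_ne a x with rfl | hax
    · rw [slot_ch_self hk] at h
      cases h
      exact lt_of_ch hk
    · rw [slot_ch_of_ne hk hax] at h
      exact (ih h).trans (lt_of_ch hk)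

theorem slot_injective {j i : Fin r} {a b : Fin 3} (ha : C.slot j a = some i)
    (hb : C.slot j b = some i) : a = b := by
  induction j using root_induction (C := C) with
  | h0 n hn => simp [slot_root hn] at ha
  | h p x k hk ih =>
    rcases eq_or_ne a x with rfl | hax <;> rcases eq_or_ne b a with rfl | hbx
    · rfl
    · rw [slot_ch_self hk] at ha
      rw [slot_ch_of_ne hk hbx] at hb
      cases ha
      exact absurd (slot_lt hb) (lt_irrefl _)
    · rfl
    · rcases eq_or_ne b x with rfl | hbx'
      · rw [slot_ch_self hk] at hb
        rw [slot_ch_of_ne hk hax] at ha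
        cases hb
        exact absurd (slot_lt ha) (lt_irrefl _)
      · rw [slot_ch_of_ne hk hax] at ha
        rw [slot_ch_of_ne hk hbx'] at hb
        exact ih ha hb

/-! ### Paths -/

theorem Desc.refl {s : Finset (Fin 3)} (n : Fin r) : C.Desc s n n := Relation.ReflTransGen.refl

theorem Desc.mono {s t : Finset (Fin 3)} (h : s ⊆ t) {n j : Fin r} (hd : C.Desc s n j) :
    C.Desc t n j :=
  Relation.ReflTransGen.mono (fun _ _ hpq => ⟨hpq.1, hpq.2.1, h hpq.2.2⟩) _ _ hd

theorem Desc.tail {s : Finset (Fin 3)} {n p k : Fin r} {x : Fin 3} (h : C.Desc s n p)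
    (hk : C.ch p x = some k) (hx : x ∈ s) : C.Desc s n k := by
  obtain ⟨h1, h2, h3⟩ := ch_eq_some.1 hk
  exact Relation.ReflTransGen.tail h ⟨h1, h2, h3 ▸ hx⟩

theorem Desc.head {s : Finset (Fin 3)} {n k j : Fin r} {x : Fin 3} (hk : C.ch n x = some k)
    (hx : x ∈ s) (h : C.Desc s k j) : C.Desc s n j := by
  obtain ⟨h1, h2, h3⟩ := ch_eq_some.1 hk
  exact Relation.ReflTransGen.head ⟨h1, h2, h3 ▸ hx⟩ h

theorem desc_iff_head {s : Finset (Fin 3)} {n j : Fin r} :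
    C.Desc s n j ↔ j = n ∨ ∃ x ∈ s, ∃ k, C.ch n x = some k ∧ C.Desc s k j := by
  constructor
  · intro h
    rcases Relation.ReflTransGen.cases_head h with rfl | ⟨k, ⟨h1, h2, h3⟩, h4⟩
    · exact Or.inl rfl
    · exact Or.inr ⟨_, h3, k, ch_eq_some.2 ⟨h1, h2, rfl⟩, h4⟩
  · rintro (rfl | ⟨x, hx, k, hk, h⟩)
    · exact Desc.refl _
    · exact Desc.head hk hx h

theorem desc_iff_tail {s : Finset (Fin 3)} {n j : Fin r} :
    C.Desc s n j ↔ j = n ∨ ∃ x ∈ s, ∃ p, C.ch p x = some j ∧ C.Desc s n p := by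
  constructor
  · intro h
    rcases Relation.ReflTransGen.cases_tail h with rfl | ⟨k, h4, h1, h2, h3⟩
    · exact Or.inl rfl
    · exact Or.inr ⟨_, h3, k, ch_eq_some.2 ⟨h1, h2, rfl⟩, h4⟩
  · rintro (rfl | ⟨x, hx, k, hk, h⟩)
    · exact Desc.refl _
    · exact h.tail hk hx

theorem Desc.induction {s : Finset (Fin 3)} {n : Fin r} {P : Fin r → Prop} (h0 : P n)
    (hs : ∀ p x k, x ∈ s → C.ch p x = some k → C.Desc s n p → P p → P k) {j : Fin r}
    (h : C.Desc s n j) : P j := by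
  induction h with
  | refl => exact h0
  | tail hp hk ih => exact hs _ _ _ hk.2.2 (ch_eq_some.2 ⟨hk.1, hk.2.1, rfl⟩) hp ih

theorem Desc.le {s : Finset (Fin 3)} {n j : Fin r} (h : C.Desc s n j) : n ≤ j :=
  h.induction (P := fun j => n ≤ j) le_rfl fun _ _ _ _ hk _ ih => ih.trans (lt_of_ch hk).le

theorem desc_root (n j : Fin r) (hn : (n : ℕ) = 0) : C.Desc univ n j := by
  induction j using root_induction (C := C) with
  | h0 k hk => rw [show k = n from Fin.ext (hk.trans hn.symm)]; exact Desc.refl n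
  | h p x k hk ih => exact ih.tail hk (mem_univ x)

theorem Desc.comparable {s t : Finset (Fin 3)} {x y j : Fin r} (hx : C.Desc s x j)
    (hy : C.Desc t y j) : C.Desc s x y ∨ C.Desc t y x := by
  revert hy
  refine hx.induction (P := fun j => C.Desc t y j → C.Desc s x y ∨ C.Desc t y x) Or.inr ?_
  intro p a k ha hk hxp ih hy
  rcases desc_iff_tail.1 hy with rfl | ⟨b, -, q, hq, hyq⟩
  · exact Or.inl (hxp.tail hk ha)
  · have : q = p := (ch_eq_some.1 hq).2.1.symm.trans (ch_eq_some.1 hk).2.1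
    exact ih (this ▸ hyq)

theorem label_eq_of_desc {s t : Finset (Fin 3)} {n k l j : Fin r} {x y : Fin 3}
    (hk : C.ch n x = some k) (hl : C.ch n y = some l) (hkj : C.Desc s k j)
    (hlj : C.Desc t l j) : x = y := by
  have key : ∀ {s : Finset (Fin 3)} {k l : Fin r} {x y : Fin 3}, C.ch n x = some k →
      C.ch n y = some l → C.Desc s k l → x = y := by
    intro s k l x y hk hl h
    rcases desc_iff_tail.1 h with rfl | ⟨b, -, q, hq, hkq⟩
    · exact (ch_eq_some.1 hk).2.2.symm.trans (ch_eq_some.1 hl).2.2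
    · have : q = n := (ch_eq_some.1 hq).2.1.symm.trans (ch_eq_some.1 hl).2.1
      exact absurd (this ▸ hkq.le) (not_le.2 (lt_of_ch hk))
  rcases hkj.comparable hlj with h | h
  · exact key hk hl h
  · exact (key hl hk h).symm

theorem descSum_none {M : Type*} [AddCommMonoid M] (s : Finset (Fin 3)) (g : Fin r → M) :
    C.descSum s g none = 0 := rfl

theorem descSum_some {M : Type*} [AddCommMonoid M] (s : Finset (Fin 3)) (g : Fin r → M)
    (n : Fin r) : C.descSum s g (some n) = g n + ∑ x ∈ s, C.descSum s g (C.ch n x) := by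
  classical
  have hset : ∀ x, C.descSum s g (C.ch n x) =
      ∑ j with ∃ k, C.ch n x = some k ∧ C.Desc s k j, g j := by
    intro x
    cases hx : C.ch n x with
    | none => simp [descSum]
    | some k => simp [descSum]
  simp only [hset]
  rw [← Finset.sum_biUnion]
  · unfold descSum
    rw [← Finset.sum_insert]
    · refine Finset.sum_congr ?_ fun _ _ => rfl
      ext j
      simp only [mem_filter, mem_univ, true_and, mem_insert, mem_biUnion]
      exact desc_iff_head
    · simp only [mem_biUnion, mem_filter, mem_univ, true_and, not_exists, not_and]
      intro x _ k hk h
      exact absurd h.le (not_le.2 (lt_of_ch hk))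
  · intro x _ y _ hxy
    rw [Function.onFun, Finset.disjoint_left]
    simp only [mem_filter, mem_univ, true_and]
    rintro j ⟨k, hk, hkj⟩ ⟨l, hl, hlj⟩
    exact hxy (label_eq_of_desc hk hl hkj hlj)

/-- A node with a given entry in position `a` descends from the child along `a` of that entry. -/
theorem slot_eq_some_iff {i j : Fin r} {a : Fin 3} :
    C.slot j a = some i ↔ ∃ k, C.ch i a = some k ∧ C.Desc {a}ᶜ k j := by
  constructor
  · intro h
    induction j using root_induction (C := C) with
    | h0 n hn => simp [slot_root hn] at h
    | h p x k hk ih =>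
      rcases eq_or_ne a x with rfl | hax
      · rw [slot_ch_self hk] at h
        cases h
        exact ⟨k, hk, Desc.refl k⟩
      · rw [slot_ch_of_ne hk hax] at h
        obtain ⟨l, hl, hd⟩ := ih h
        exact ⟨l, hl, hd.tail hk (by simpa using hax.symm)⟩
  · rintro ⟨k, hk, hd⟩
    refine hd.induction (P := fun j => C.slot j a = some i) (slot_ch_self hk) ?_
    intro p x l hx hl _ ih
    rw [slot_ch_of_ne hl (by simpa [eq_comm] using hx), ih]

/-- Entries of a descendant that are older than the ancestor are entries of the ancestor. -/
theorem Desc.slot_eq {s : Finset (Fin 3)} {j k i : Fin r} {a : Fin 3} (h : C.Desc s j k)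
    (hk : C.slot k a = some i) (hi : i < j) : C.slot j a = some i ∧ C.Desc {a}ᶜ j k := by
  revert hk
  refine h.induction (P := fun k => C.slot k a = some i → C.slot j a = some i ∧ C.Desc {a}ᶜ j k)
    (fun hk => ⟨hk, Desc.refl j⟩) ?_
  intro p x l _ hl hjp ih hla
  rcases eq_or_ne a x with rfl | hax
  · rw [slot_ch_self hl] at hla
    cases hla
    exact absurd hjp.le (not_le.2 hi)
  · rw [slot_ch_of_ne hl hax] at hla
    exact ⟨(ih hla).1, (ih hla).2.tail hl (by simpa using hax.symm)⟩

theorem Desc.slot_of_notMem {s : Finset (Fin 3)} {j k : Fin r} {a : Fin 3} (h : C.Desc s j k)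
    (ha : a ∉ s) : C.slot k a = C.slot j a := by
  refine h.induction (P := fun k => C.slot k a = C.slot j a) rfl ?_
  intro p x l hx hl _ ih
  have hax : a ≠ x := by
    rintro rfl
    exact ha hx
  rw [slot_ch_of_ne hl hax, ih]

/-! ### Coordinates and proximity -/

variable (C) in
/-- Coordinates with respect to the cone of a node. -/
def crd (i : Fin r) (w : Fin 3 → ℤ) : Fin 3 → ℤ :=
  if h : 0 < (i : ℕ) then fun y =>
    if y = C.label i then crd (C.parent i) w y
    else crd (C.parent i) w y - crd (C.parent i) w (C.label i)
  else w
termination_by (i : ℕ)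
decreasing_by all_goals exact C.parent_lt i h

theorem crd_root {n : Fin r} (h : (n : ℕ) = 0) (w : Fin 3 → ℤ) : C.crd n w = w := by
  rw [crd, dif_neg (by omega)]

theorem crd_ch {p k : Fin r} {x : Fin 3} (h : C.ch p x = some k) (w : Fin 3 → ℤ) (y : Fin 3) :
    C.crd k w y = if y = x then C.crd p w y else C.crd p w y - C.crd p w x := by
  obtain ⟨h1, rfl, rfl⟩ := ch_eq_some.1 h
  rw [crd, dif_pos h1]

theorem cone_root {n : Fin r} (h : (n : ℕ) = 0) (a : Fin 3) : C.cone n a = Pi.single a 1 := by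
  rw [cone, dif_neg (by omega)]

theorem cone_ch {p k : Fin r} {x : Fin 3} (h : C.ch p x = some k) :
    C.cone k = Function.update (C.cone p) x (C.v p) := by
  obtain ⟨h1, rfl, rfl⟩ := ch_eq_some.1 h
  rw [cone, dif_pos h1, v]

theorem crd_add (i : Fin r) (w u : Fin 3 → ℤ) : C.crd i (w + u) = C.crd i w + C.crd i u := by
  induction i using root_induction (C := C) with
  | h0 n hn => simp [crd_root hn]
  | h p x k hk ih =>
    funext y
    simp only [Pi.add_apply, crd_ch hk, ih]
    split_ifs <;> ring

theorem crd_v_of_cone {i p : Fin r} (h : ∀ a, C.crd i (C.cone p a) = Pi.single a 1) :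
    C.crd i (C.v p) = fun _ => 1 := by
  rw [v, Fin.sum_univ_three, crd_add, crd_add, h, h, h]
  funext y
  fin_cases y <;> simp

theorem crd_cone (i : Fin r) (a : Fin 3) : C.crd i (C.cone i a) = Pi.single a 1 := by
  induction i using root_induction (C := C) generalizing a with
  | h0 n hn => rw [crd_root hn, cone_root hn]
  | h p x k hk ih =>
    funext y
    rw [cone_ch hk, crd_ch hk]
    rcases eq_or_ne a x with rfl | hax
    · rw [Function.update_self, crd_v_of_cone ih]
      by_cases hy : y = a <;> simp [hy]
    · rw [Function.update_of_ne hax, ih]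
      by_cases hy : y = x
      · simp [hy]
      · simp [hy, hax.symm]

theorem crd_v (i : Fin r) (a : Fin 3) : C.crd i (C.v i) a = 1 := by
  rw [crd_v_of_cone (crd_cone i)]

theorem crd_v_pos (i : Fin r) (a : Fin 3) : 0 < C.crd i (C.v i) a := by
  rw [crd_v]
  exact one_pos

theorem crd_pos_parent {p k : Fin r} {x : Fin 3} (h : C.ch p x = some k) {w : Fin 3 → ℤ}
    (hw : ∀ a, 0 < C.crd k w a) :
    (∀ a, 0 < C.crd p w a) ∧ ∀ a, a ≠ x → C.crd p w x < C.crd p w a := by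
  have hx : 0 < C.crd p w x := by simpa [crd_ch h] using hw x
  have h2 : ∀ a, a ≠ x → C.crd p w x < C.crd p w a := by
    intro a ha
    have := hw a
    rw [crd_ch h, if_neg ha] at this
    linarith
  refine ⟨fun a => ?_, h2⟩
  rcases eq_or_ne a x with rfl | ha
  · exact hx
  · exact hx.trans (h2 a ha)

theorem crd_pos_desc {s : Finset (Fin 3)} {p k : Fin r} (h : C.Desc s p k) {w : Fin 3 → ℤ}
    (hw : ∀ a, 0 < C.crd k w a) (a : Fin 3) : 0 < C.crd p w a := by
  revert hw
  refine h.induction (P := fun k => (∀ a, 0 < C.crd k w a) → 0 < C.crd p w a)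
    (fun h => h a) fun _ _ _ _ hk _ ih hw => ih (crd_pos_parent hk hw).1

theorem v_pos (i : Fin r) (a : Fin 3) : 0 < C.v i a := by
  have hr : 0 < r := (Nat.zero_le _).trans_lt i.isLt
  have := crd_pos_desc (desc_root (C := C) ⟨0, hr⟩ i rfl) (w := C.v i) (crd_v_pos i) a
  rwa [crd_root rfl] at this

theorem desc_of_crd_pos {i j : Fin r} (h : ∀ a, 0 < C.crd j (C.v i) a) : C.Desc univ j i := by
  induction j using root_induction (C := C) with
  | h0 n hn => exact desc_root n i hn
  | h p x k hk ih =>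
    obtain ⟨h1, h2⟩ := crd_pos_parent hk h
    rcases desc_iff_head.1 (ih h1) with rfl | ⟨y, -, l, hl, hd⟩
    · obtain ⟨y, hy⟩ := exists_ne x
      have := h2 y hy
      rw [crd_v, crd_v] at this
      exact absurd this (lt_irrefl _)
    · have h3 := (crd_pos_parent hl (fun a => crd_pos_desc hd (crd_v_pos i) a)).2
      have hxy : x = y := by
        by_contra hne
        exact absurd (h2 y (Ne.symm hne)) (not_lt.2 (h3 x hne).le)
      subst hxy
      rw [hk] at hl
      cases hl
      exact hd

theorem v_injective : Function.Injective C.v := by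
  intro i j h
  have h1 : C.Desc univ j i := desc_of_crd_pos fun a => by rw [h, crd_v]; exact one_pos
  have h2 : C.Desc univ i j := desc_of_crd_pos fun a => by rw [← h, crd_v]; exact one_pos
  exact le_antisymm h2.le h1.le

theorem cone_eq (j : Fin r) (a : Fin 3) :
    C.cone j a = (C.slot j a).elim (Pi.single a 1) C.v := by
  induction j using root_induction (C := C) with
  | h0 n hn => simp [cone_root hn, slot_root hn]
  | h p x k hk ih =>
    rcases eq_or_ne a x with rfl | hax
    · simp [cone_ch hk, slot_ch_self hk]
    · rw [cone_ch hk, slot_ch_of_ne hk hax, Function.update_of_ne hax, ih]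

theorem prox_iff {j i : Fin r} : C.Prox j i ↔ ∃ a, C.slot j a = some i := by
  constructor
  · rintro ⟨-, a, h⟩
    refine ⟨a, ?_⟩
    rw [cone_eq] at h
    cases hs : C.slot j a with
    | none =>
      rw [hs] at h
      obtain ⟨b, hb⟩ := exists_ne a
      have := v_pos (C := C) i b
      rw [← h] at this
      simp [hb] at this
    | some k =>
      rw [hs] at h
      exact congrArg some (v_injective h)
  · rintro ⟨a, h⟩
    exact ⟨(slot_lt h).ne', a, by rw [cone_eq, h]; rfl⟩

theorem Prox.lt {j i : Fin r} (h : C.Prox j i) : i < j := by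
  obtain ⟨a, ha⟩ := prox_iff.1 h
  exact slot_lt ha

theorem inChain_iff {i j : Fin r} {a b : Fin 3} :
    C.inChain i a b j = true ↔ ∃ k, C.ch i a = some k ∧ C.Desc {b} k j := by
  induction j using root_induction (C := C) with
  | h0 n hn =>
    rw [inChain, dif_neg (by omega)]
    simp only [Bool.false_eq_true, false_iff, not_exists, not_and]
    intro k hk hd
    have h1 : (i : ℕ) < k := lt_of_ch hk
    have h2 : (k : ℕ) ≤ n := hd.le
    omega
  | h p x k hk ih =>
    obtain ⟨h1, rfl, rfl⟩ := ch_eq_some.1 hk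
    rw [inChain, dif_pos h1]
    simp only [Bool.or_eq_true, Bool.and_eq_true, decide_eq_true_eq, ih]
    constructor
    · rintro (⟨rfl, rfl⟩ | ⟨rfl, l, hl, hd⟩)
      · exact ⟨k, hk, Desc.refl k⟩
      · exact ⟨l, hl, hd.tail hk (by simp)⟩
    · rintro ⟨l, hl, hd⟩
      rcases desc_iff_tail.1 hd with rfl | ⟨y, hy, q, hq, hd'⟩
      · exact Or.inl (ch_eq_some.1 hl).2
      · obtain ⟨-, rfl, rfl⟩ := ch_eq_some.1 hq
        exact Or.inr ⟨by simpa using hy, l, hl, hd'⟩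

end ToricConstellation

/-! ### The three labels -/

theorem Fin3.eq_or {a b c : Fin 3} (hab : a ≠ b) (hac : a ≠ c) (hbc : b ≠ c) (x : Fin 3) :
    x = a ∨ x = b ∨ x = c := by
  revert a b c x
  decide

theorem Fin3.compl_eq {a b c : Fin 3} (hab : a ≠ b) (hac : a ≠ c) (hbc : b ≠ c) :
    ({a}ᶜ : Finset (Fin 3)) = {b, c} := by
  revert a b c
  decide

theorem Fin3.univ_eq {a b c : Fin 3} (hab : a ≠ b) (hac : a ≠ c) (hbc : b ≠ c) :
    (univ : Finset (Fin 3)) = {a, b, c} := by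
  revert a b c
  decide

theorem Fin3.sum_eq {M : Type*} [AddCommMonoid M] {a b c : Fin 3} (hab : a ≠ b) (hac : a ≠ c)
    (hbc : b ≠ c) (f : Fin 3 → M) : ∑ x, f x = f a + f b + f c := by
  rw [Fin3.univ_eq hab hac hbc, sum_insert (by simp [hab, hac]), sum_pair hbc, add_assoc]

theorem Fin3.exists_others (a : Fin 3) : ∃ b c : Fin 3, a ≠ b ∧ a ≠ c ∧ b ≠ c := by
  revert a
  decide

namespace ToricCluster

open ToricConstellation

variable {r : ℕ} {A : ToricCluster r}

theorem sum_slot_eq {M : Type*} [AddCommMonoid M] (g : Fin r → M) (i : Fin r) (a : Fin 3) :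
    ∑ j with A.slot j a = some i, g j = A.descSum {a}ᶜ g (A.ch i a) := by
  cases hk : A.ch i a with
  | none =>
    refine sum_eq_zero fun j hj => ?_
    obtain ⟨l, hl, -⟩ := slot_eq_some_iff.1 (mem_filter.1 hj).2
    rw [hk] at hl
    cases hl
  | some k =>
    refine sum_congr ?_ fun _ _ => rfl
    ext j
    simp [slot_eq_some_iff, hk]

theorem sum_proxSet {M : Type*} [AddCommMonoid M] (g : Fin r → M) (i : Fin r) :
    ∑ j ∈ A.proxSet i, g j = ∑ a, ∑ j with A.slot j a = some i, g j := by
  rw [← sum_biUnion]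
  · refine sum_congr ?_ fun _ _ => rfl
    ext j
    simp [proxSet, prox_iff]
  · intro a _ b _ hab
    rw [Function.onFun, disjoint_left]
    simp only [mem_filter, mem_univ, true_and]
    exact fun j ha hb => hab (slot_injective ha hb)

theorem sum_Bset {M : Type*} [AddCommMonoid M] (g : Fin r → M) (i : Fin r) :
    ∑ j ∈ A.Bset i, g j = ∑ a, (A.slot i a).elim 0 g := by
  have h : ∀ a, (A.slot i a).elim 0 g = ∑ j with A.slot i a = some j, g j := by
    intro a
    cases A.slot i a <;> simp [sum_filter]
  simp only [h]
  rw [← sum_biUnion]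
  · refine sum_congr ?_ fun _ _ => rfl
    ext j
    simp [Bset, prox_iff]
  · intro a _ b _ hab
    rw [Function.onFun, disjoint_left]
    simp only [mem_filter, mem_univ, true_and]
    exact fun j ha hb => hab (slot_injective ha hb)

theorem anteSet_eq (i : Fin r) : A.anteSet i = A.Bset i := by
  ext j
  simp only [anteSet, Bset, mem_filter, mem_univ, true_and]
  exact ⟨fun h => h.2, fun h => ⟨h.lt, h⟩⟩

theorem N_eq (i : Fin r) : A.N i = A.m i + ∑ a, (A.slot i a).elim 0 A.N := by
  rw [N, sum_attach (A.anteSet i) A.N, anteSet_eq, sum_Bset]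

theorem nu_eq (i : Fin r) : A.nu i = ∑ a, (A.slot i a).elim 1 A.nu := by
  rw [nu, sum_attach (A.anteSet i) fun j => A.nu j - 1, anteSet_eq, sum_Bset,
    show (3 : ℤ) = ∑ _a : Fin 3, 1 by simp, ← sum_add_distrib]
  refine sum_congr rfl fun a _ => ?_
  cases A.slot i a <;> simp

theorem N_pos (i : Fin r) : 0 < A.N i := by
  induction hk : (i : ℕ) using Nat.strong_induction_on generalizing i with
  | _ t ih =>
    rw [N_eq]
    refine add_pos_of_pos_of_nonneg (A.m_pos i) (sum_nonneg fun a _ => ?_)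
    cases h : A.slot i a with
    | none => exact le_rfl
    | some j => exact (ih j (hk ▸ slot_lt h) j rfl).le

theorem M_eq (i : Fin r) (a b : Fin 3) : A.M i a b = A.descSum {b} A.m (A.ch i a) := by
  unfold M
  cases hk : A.ch i a with
  | none =>
    refine sum_eq_zero fun j hj => ?_
    obtain ⟨l, hl, -⟩ := inChain_iff.1 (mem_filter.1 hj).2
    rw [hk] at hl
    cases hl
  | some k =>
    refine sum_congr ?_ fun _ _ => rfl
    ext j
    simp [inChain_iff, hk]

theorem M_none {i : Fin r} {a : Fin 3} (h : A.ch i a = none) (b : Fin 3) : A.M i a b = 0 := by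
  rw [M_eq, h, descSum_none]

theorem M_some {i k : Fin r} {a : Fin 3} (h : A.ch i a = some k) (b : Fin 3) :
    A.M i a b = A.m k + A.M k b b := by
  rw [M_eq, h, descSum_some, sum_singleton, M_eq]

theorem M_nonneg (i : Fin r) (a b : Fin 3) : 0 ≤ A.M i a b :=
  sum_nonneg fun j _ => (A.m_pos j).le

theorem ch_eq_none_of_M {i : Fin r} {a b : Fin 3} (h : A.M i a b ≤ 0) : A.ch i a = none := by
  cases hk : A.ch i a with
  | none => rfl
  | some k =>
    rw [M_some hk] at h
    have := A.m_pos k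
    have := M_nonneg (A := A) k b b
    omega

/-- For a node `k` proximate to `i`, being linearly proximate to `j → i`. -/
theorem linProx_iff {i j k : Fin r} {s y z : Fin 3} (hsy : s ≠ y) (hsz : s ≠ z) (hyz : y ≠ z)
    (hs : A.slot j s = some i) :
    A.Prox k i ∧ A.LinProx k j ↔
      (∃ l, A.ch j y = some l ∧ A.Desc {z} l k) ∨ (∃ l, A.ch j z = some l ∧ A.Desc {y} l k) := by
  constructor
  · rintro ⟨hki, a, b, hab, hc⟩
    obtain ⟨l, hl, hd⟩ := inChain_iff.1 hc
    obtain ⟨t, ht⟩ := prox_iff.1 hki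
    have hij := slot_lt hs
    have hd' : A.Desc univ j k := (hd.mono (subset_univ _)).head hl (mem_univ _)
    obtain ⟨h1, h2⟩ := hd'.slot_eq ht hij
    obtain rfl := slot_injective h1 hs
    have hjk : j < k := (lt_of_ch hl).trans_le hd.le
    have ha : a ≠ t := by
      rcases desc_iff_head.1 h2 with rfl | ⟨x, hx, l', hl', hd'⟩
      · exact absurd hjk (lt_irrefl _)
      · rw [label_eq_of_desc hl hl' hd hd']
        simpa using hx
    have hb : b = t → k = l := by
      rintro rfl
      rcases desc_iff_tail.1 hd with h | ⟨x, hx, p, hp, hlp⟩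
      · exact h
      · rw [mem_singleton] at hx
        subst hx
        rw [slot_ch_self hp] at ht
        cases ht
        exact absurd (hij.trans (lt_of_ch hl)) (not_lt.2 hlp.le)
    rcases Fin3.eq_or hsy hsz hyz a with rfl | rfl | rfl
    · exact absurd rfl ha
    · refine Or.inl ⟨l, hl, ?_⟩
      rcases Fin3.eq_or hsy hsz hyz b with rfl | rfl | rfl
      · rw [hb rfl]
        exact Desc.refl l
      · exact absurd rfl hab
      · exact hd
    · refine Or.inr ⟨l, hl, ?_⟩
      rcases Fin3.eq_or hsy hsz hyz b with rfl | rfl | rfl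
      · rw [hb rfl]
        exact Desc.refl l
      · exact hd
      · exact absurd rfl hab
  · have key : ∀ {y z : Fin 3}, s ≠ y → s ≠ z → y ≠ z →
        (∃ l, A.ch j y = some l ∧ A.Desc {z} l k) → A.Prox k i ∧ A.LinProx k j := by
      rintro y z hsy hsz hyz ⟨l, hl, hd⟩
      refine ⟨prox_iff.2 ⟨s, ?_⟩, y, z, hyz, inChain_iff.2 ⟨l, hl, hd⟩⟩
      rw [hd.slot_of_notMem (by simpa using hsz), slot_ch_of_ne hl hsy, hs]
    rintro (h | h)
    · exact key hsy hsz hyz h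
    · exact key hsz hsy hyz.symm h

theorem sum_linProx {M : Type*} [AddCommMonoid M] (g : Fin r → M) {i j : Fin r} {s y z : Fin 3}
    (hsy : s ≠ y) (hsz : s ≠ z) (hyz : y ≠ z) (hs : A.slot j s = some i) :
    ∑ k with A.Prox k i ∧ A.LinProx k j, g k =
      A.descSum {z} g (A.ch j y) + A.descSum {y} g (A.ch j z) := by
  classical
  have h : ∀ y z, A.descSum {z} g (A.ch j y) =
      ∑ k with ∃ l, A.ch j y = some l ∧ A.Desc {z} l k, g k := by
    intro y z
    cases A.ch j y <;> simp [descSum]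
  rw [h, h, ← sum_union]
  · refine sum_congr ?_ fun _ _ => rfl
    ext k
    simp only [mem_filter, mem_univ, true_and, mem_union]
    exact linProx_iff hsy hsz hyz hs
  · rw [disjoint_left]
    simp only [mem_filter, mem_univ, true_and]
    rintro k ⟨l, hl, hd⟩ ⟨l', hl', hd'⟩
    exact hyz (label_eq_of_desc hl hl' hd hd')

theorem chi0pair_eq {i j : Fin r} {s y z : Fin 3}
    (hsy : s ≠ y) (hsz : s ≠ z) (hyz : y ≠ z) (hs : A.slot j s = some i) :
    A.chi0pair i j = A.rab j y z := by
  rw [chi0pair, rab, M_eq, M_eq, proxSet, filter_filter, sum_linProx A.m hsy hsz hyz hs]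
  ring

theorem descSum_rab {s y z : Fin 3} (hsy : s ≠ y) (hsz : s ≠ z) (hyz : y ≠ z) (i : Fin r) :
    A.descSum {s}ᶜ (fun j => A.rab j y z) (A.ch i s) =
      A.M i s y + A.M i s z - A.descSum {s}ᶜ A.m (A.ch i s) := by
  have key : ∀ n : Fin r, A.descSum {s}ᶜ (fun j => A.rab j y z) (some n) =
      A.m n + A.M n y y + (A.m n + A.M n z z) - A.descSum {s}ᶜ A.m (some n) := by
    intro n
    induction n using ch_induction (C := A.toToricConstellation) with
    | h n ih =>
      have step : ∀ x, A.descSum {s}ᶜ (fun j => A.rab j y z) (A.ch n x) =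
          A.M n x y + A.M n x z - A.descSum {s}ᶜ A.m (A.ch n x) := by
        intro x
        cases hx : A.ch n x with
        | none => simp [M_none hx, descSum_none]
        | some k => rw [ih x k hx, M_some hx, M_some hx]
      rw [descSum_some, descSum_some, Fin3.compl_eq hsy hsz hyz, sum_pair hyz, sum_pair hyz,
        ← Fin3.compl_eq hsy hsz hyz, step, step, rab]
      ring
  cases hx : A.ch i s with
  | none => simp [M_none hx, descSum_none]
  | some k => rw [key, M_some hx, M_some hx]

theorem chi_eq {a b c : Fin 3} (hab : a ≠ b) (hac : a ≠ c) (hbc : b ≠ c) (i : Fin r) :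
    A.chi i = A.D i - ((if A.slot i a = none then A.rab i b c else 0)
      + (if A.slot i b = none then A.rab i a c else 0)
      + (if A.slot i c = none then A.rab i a b else 0)) + A.T i := by
  have rsymm : ∀ x y, A.rab i x y = A.rab i y x := fun x y => by unfold rab; ring
  have h1 : ∑ j ∈ A.proxSet i, A.chi0pair i j = A.M i a b + A.M i a c + (A.M i b a + A.M i b c)
      + (A.M i c a + A.M i c b) - ∑ j ∈ A.proxSet i, A.m j := by
    have key : ∀ {s y z : Fin 3}, s ≠ y → s ≠ z → y ≠ z →
        ∑ j with A.slot j s = some i, A.chi0pair i j =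
          A.M i s y + A.M i s z - ∑ j with A.slot j s = some i, A.m j := by
      intro s y z hsy hsz hyz
      rw [sum_slot_eq A.m, ← descSum_rab hsy hsz hyz, ← sum_slot_eq]
      refine sum_congr rfl fun j hj => ?_
      exact chi0pair_eq hsy hsz hyz (mem_filter.1 hj).2
    rw [sum_proxSet, sum_proxSet, Fin3.sum_eq hab hac hbc, Fin3.sum_eq hab hac hbc,
      key hab hac hbc, key hab.symm hbc hac, key hac.symm hbc.symm hab]
    ring
  have h2 : ∑ j ∈ A.Bset i, A.chi0pair j i = (if A.slot i a = none then 0 else A.rab i b c)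
      + (if A.slot i b = none then 0 else A.rab i a c)
      + (if A.slot i c = none then 0 else A.rab i a b) := by
    rw [sum_Bset, Fin3.sum_eq hab hac hbc]
    congr 1
    · congr 1
      · cases h : A.slot i a with
        | none => simp
        | some j => simpa using chi0pair_eq hab hac hbc h
      · cases h : A.slot i b with
        | none => simp
        | some j => simpa using chi0pair_eq hab.symm hbc hac h
    · cases h : A.slot i c with
        | none => simp
        | some j => simpa using chi0pair_eq hac.symm hbc.symm hab h
  have h3 : ∑ j ∈ A.proxSet i, A.m j * (A.m j - 1) =
      ∑ j ∈ A.proxSet i, A.m j ^ 2 - ∑ j ∈ A.proxSet i, A.m j := by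
    rw [← sum_sub_distrib]
    exact sum_congr rfl fun _ _ => by ring
  have h4 : A.chi i = 3 + A.m i * (A.m i - 3) - ∑ j ∈ A.proxSet i, A.m j * (A.m j - 1)
    + ∑ j ∈ A.proxSet i, A.chi0pair i j + ∑ j ∈ A.Bset i, A.chi0pair j i
    - ((A.Aset i).card : ℤ) - 2 * ((A.Bset i).card : ℤ)
    + (((A.Bset i).card.choose 2 : ℕ) : ℤ) := rfl
  rw [h4, h1, h2, h3, D, T]
  have e : ∀ (P : Prop) [Decidable P] (t : ℤ), (if P then 0 else t) = t - if P then t else 0 := by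
    intro P _ t
    split_ifs <;> ring
  rw [e, e, e]
  simp only [rab]
  ring

end ToricCluster

/-! ### Integer inequalities at a node -/

/-- The inequalities satisfied by the weights at a node of an idealistic cluster: `m` is the
weight of the node, `ma, mb, mc` those of its children (`0` for a missing child), `Ab` is the
sum of the weights along the path starting with the label `a` and continuing with `b`, and `Sa`
is the sum of the squares of the weights of the proximate nodes above the child along `a`. -/
structure NodeBounds (m ma mb mc Ab Ac Ba Bc Ca Cb Sa Sb Sc : ℤ) : Prop where
  pos : 1 ≤ m
  hab : Ab + Ba ≤ m
  hac : Ac + Ca ≤ m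
  hbc : Bc + Cb ≤ m
  ha : (ma = 0 ∧ Ab = 0 ∧ Ac = 0 ∧ Sa = 0) ∨ (1 ≤ ma ∧ ma ≤ Ab ∧ ma ≤ Ac)
  hb : (mb = 0 ∧ Ba = 0 ∧ Bc = 0 ∧ Sb = 0) ∨ (1 ≤ mb ∧ mb ≤ Ba ∧ mb ≤ Bc)
  hc : (mc = 0 ∧ Ca = 0 ∧ Cb = 0 ∧ Sc = 0) ∨ (1 ≤ mc ∧ mc ≤ Ca ∧ mc ≤ Cb)
  sa : Sa ≤ Ab * Ac
  sb : Sb ≤ Ba * Bc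
  sc : Sc ≤ Ca * Cb
  sa' : Sa ≤ ma * Ab ∨ Sa ≤ ma * Ac
  sb' : Sb ≤ mb * Ba ∨ Sb ≤ mb * Bc
  sc' : Sc ≤ mc * Ca ∨ Sc ≤ mc * Cb

namespace NodeBounds

variable {m ma mb mc Ab Ac Ba Bc Ca Cb Sa Sb Sc : ℤ}

theorem swap_left (h : NodeBounds m ma mb mc Ab Ac Ba Bc Ca Cb Sa Sb Sc) :
    NodeBounds m mb ma mc Ba Bc Ab Ac Cb Ca Sb Sa Sc where
  pos := h.pos
  hab := by linarith [h.hab]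
  hac := h.hbc
  hbc := h.hac
  ha := h.hb
  hb := h.ha
  hc := by have := h.hc; tauto
  sa := h.sb
  sb := h.sa
  sc := by linarith [h.sc]
  sa' := h.sb'
  sb' := h.sa'
  sc' := h.sc'.symm

theorem swap_right (h : NodeBounds m ma mb mc Ab Ac Ba Bc Ca Cb Sa Sb Sc) :
    NodeBounds m ma mc mb Ac Ab Ca Cb Ba Bc Sa Sc Sb where
  pos := h.pos
  hab := h.hac
  hac := h.hab
  hbc := by linarith [h.hbc]
  ha := by have := h.ha; tauto
  hb := h.hc
  hc := h.hb
  sa := by linarith [h.sa]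
  sb := by linarith [h.sc]
  sc := by linarith [h.sb]
  sa' := h.sa'.symm
  sb' := h.sc'
  sc' := h.sb'

theorem nonneg_a (h : NodeBounds m ma mb mc Ab Ac Ba Bc Ca Cb Sa Sb Sc) :
    0 ≤ ma ∧ 0 ≤ Ab ∧ 0 ≤ Ac := by
  rcases h.ha with ⟨h1, h2, h3, -⟩ | ⟨h1, h2, h3⟩ <;> refine ⟨?_, ?_, ?_⟩ <;> linarith

theorem nonneg_b (h : NodeBounds m ma mb mc Ab Ac Ba Bc Ca Cb Sa Sb Sc) :
    0 ≤ mb ∧ 0 ≤ Ba ∧ 0 ≤ Bc := h.swap_left.nonneg_a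

theorem nonneg_c (h : NodeBounds m ma mb mc Ab Ac Ba Bc Ca Cb Sa Sb Sc) :
    0 ≤ mc ∧ 0 ≤ Ca ∧ 0 ≤ Cb := h.swap_right.nonneg_b

theorem defect_mul_le (h : NodeBounds m ma mb mc Ab Ac Ba Bc Ca Cb Sa Sb Sc) :
    (m - Bc - Cb) * (m - ma) ≤ m ^ 2 - Sa - Sb - Sc := by
  obtain ⟨ha1, ha2, ha3⟩ := h.nonneg_a
  obtain ⟨hb1, hb2, hb3⟩ := h.nonneg_b
  obtain ⟨hc1, hc2, hc3⟩ := h.nonneg_c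
  have e1 : Sb ≤ (m - Ab) * Bc :=
    h.sb.trans (mul_le_mul_of_nonneg_right (by linarith [h.hab]) hb3)
  have e2 : Sc ≤ (m - Ac) * Cb :=
    h.sc.trans (mul_le_mul_of_nonneg_right (by linarith [h.hac]) hc3)
  have e3 : ma ≤ Ab ∧ ma ≤ Ac := by
    rcases h.ha with ⟨h1, h2, h3, -⟩ | ⟨h1, h2, h3⟩ <;> constructor <;> linarith
  have e4 := mul_nonneg hb3 (sub_nonneg.2 e3.1)
  have e5 := mul_nonneg hc3 (sub_nonneg.2 e3.2)
  rcases h.sa' with h6 | h6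
  · have := mul_nonneg ha1 (show 0 ≤ m - Ab by linarith [h.hab])
    nlinarith
  · have := mul_nonneg ha1 (show 0 ≤ m - Ac by linarith [h.hac])
    nlinarith

theorem child_le (h : NodeBounds m ma mb mc Ab Ac Ba Bc Ca Cb Sa Sb Sc) : ma ≤ m := by
  have := h.pos
  have := h.hab
  have := h.nonneg_b.2.1
  rcases h.ha with ⟨h1, h2, h3, -⟩ | ⟨h1, h2, h3⟩ <;> linarith

theorem area_nonneg (h : NodeBounds m ma mb mc Ab Ac Ba Bc Ca Cb Sa Sb Sc) :
    0 ≤ m ^ 2 - Sa - Sb - Sc :=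
  (mul_nonneg (by linarith [h.hbc]) (by linarith [h.child_le])).trans h.defect_mul_le

theorem mul_add_mul_sub_mul_nonneg {m p u w : ℤ} (hm : 0 < m) (hp : 0 ≤ p) (hpm : p ≤ m)
    (hu : 0 ≤ u) (hum : u ≤ m) (hw : 0 ≤ w) (hwm : w ≤ m) :
    0 ≤ (m - p) * w + p * u - u * w := by
  have h1 := mul_nonneg (mul_nonneg (sub_nonneg.2 hpm) hw) (sub_nonneg.2 hum)
  have h2 := mul_nonneg (mul_nonneg hp hu) (sub_nonneg.2 hwm)
  refine nonneg_of_mul_nonneg_right (a := m) ?_ hm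
  linarith

theorem area_ge (h : NodeBounds m ma mb mc Ab Ac Ba Bc Ca Cb Sa Sb Sc) :
    (m - Ab - Ba) * Bc + (m - Ab) * (m - Bc - Cb) + Ab * (m - Ac - Ca)
      + ((m - Ab) * Cb + Ab * Ca - Ca * Cb) ≤ m ^ 2 - Sa - Sb - Sc := by
  linarith [h.sa, h.sb, h.sc]

theorem area_ge_of_pos (h : NodeBounds m ma mb mc Ab Ac Ba Bc Ca Cb Sa Sb Sc) (h1 : 1 ≤ Ab)
    (h2 : Ab ≤ m - 1) : (m - Ab - Ba) * Bc + (m - Bc - Cb) + (m - Ac - Ca)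
      + ((m - Ab) * Cb + Ab * Ca - Ca * Cb) ≤ m ^ 2 - Sa - Sb - Sc := by
  have e1 := mul_nonneg (show 0 ≤ m - Ab - 1 by linarith) (show 0 ≤ m - Bc - Cb by linarith [h.hbc])
  have e2 := mul_nonneg (show 0 ≤ Ab - 1 by linarith) (show 0 ≤ m - Ac - Ca by linarith [h.hac])
  linarith [h.area_ge]

theorem bracket_nonneg (h : NodeBounds m ma mb mc Ab Ac Ba Bc Ca Cb Sa Sb Sc) :
    0 ≤ (m - Ab) * Cb + Ab * Ca - Ca * Cb := by
  have := h.nonneg_a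
  have := h.nonneg_b
  have := h.nonneg_c
  exact mul_add_mul_sub_mul_nonneg (by linarith [h.pos]) (by linarith) (by linarith [h.hab])
    (by linarith) (by linarith [h.hac]) (by linarith) (by linarith [h.hbc])

theorem one_occupied_of_pos (h : NodeBounds m ma mb mc Ab Ac Ba Bc Ca Cb Sa Sb Sc) (h1 : 1 ≤ Ab)
    (h2 : Ab ≤ m - 1) :
    0 ≤ m ^ 2 - Sa - Sb - Sc - (m - Bc - Cb) - (m - Ac - Ca) := by
  have := mul_nonneg (show 0 ≤ m - Ab - Ba by linarith [h.hab]) h.nonneg_b.2.2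
  linarith [h.area_ge_of_pos h1 h2, h.bracket_nonneg]

theorem one_occupied_of_full (h : NodeBounds m ma mb mc Ab Ac Ba Bc Ca Cb Sa Sb Sc)
    (hma : ma < m) (h1 : Ab = m) {δ : ℤ} (hδ : mc = 0 ∧ δ = 0 ∨ 1 ≤ mc ∧ δ = 1) :
    0 ≤ m ^ 2 - Sa - Sb - Sc - (m - Bc - Cb) - (m - Ac - Ca) + 1 - δ := by
  have hpos := h.pos
  have hb : mb = 0 ∧ Ba = 0 ∧ Bc = 0 ∧ Sb = 0 := by
    rcases h.hb with hb | hb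
    · exact hb
    · linarith [h.hab]
  have ha : 1 ≤ ma ∧ ma ≤ Ab ∧ ma ≤ Ac := by
    rcases h.ha with ha | ha
    · linarith
    · exact ha
  obtain ⟨-, hBa, hBc, hSb⟩ := hb
  have hSa : Sa ≤ ma * m := by
    rcases h.sa' with h6 | h6
    · rwa [h1] at h6
    · exact h6.trans (mul_le_mul_of_nonneg_left (by linarith [h.hac, h.nonneg_c.2.1])
        (by linarith))
  rcases hδ with ⟨h0, rfl⟩ | ⟨h0, rfl⟩
  · rcases h.hc with ⟨-, hCa, hCb, hSc⟩ | hc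
    · have := mul_nonneg (show 0 ≤ m - 1 by linarith) (show 0 ≤ m - 1 - ma by linarith)
      nlinarith
    · linarith
  · rcases h.hc with hc | hc
    · linarith
    · have e1 := mul_nonneg (show 0 ≤ m - 1 by linarith)
        (show 0 ≤ m - ma - Ca by linarith [h.hac])
      have e2 := mul_nonneg (show 0 ≤ Ca - 1 by linarith)
        (show 0 ≤ m - Cb by linarith [h.hbc])
      have := h.sc
      nlinarith

theorem one_occupied_nonneg (h : NodeBounds m ma mb mc Ab Ac Ba Bc Ca Cb Sa Sb Sc)
    (hma : ma < m) (hmb : mb < m) {δ : ℤ} (hδ : mc = 0 ∧ δ = 0 ∨ 1 ≤ mc ∧ δ = 1) :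
    0 ≤ m ^ 2 - Sa - Sb - Sc - (m - Bc - Cb) - (m - Ac - Ca) + 1 - δ := by
  have hpos := h.pos
  have hδ1 : δ ≤ 1 := by rcases hδ with ⟨-, h⟩ | ⟨-, h⟩ <;> linarith
  rcases h.ha with ⟨-, hAb, hAc, hSa⟩ | ha
  · rcases h.hb with ⟨-, hBa, hBc, hSb⟩ | hb
    · rcases hδ with ⟨h0, rfl⟩ | ⟨h0, rfl⟩
      · rcases h.hc with ⟨-, hCa, hCb, hSc⟩ | hc
        · nlinarith
        · linarith
      · rcases h.hc with hc | hc
        · linarith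
        · have e1 : (Ca - 1) * (Cb - 1) ≤ (m - 1) * (m - 1) :=
            mul_le_mul (by linarith [h.hac]) (by linarith [h.hbc]) (by linarith) (by linarith)
          have := h.sc
          nlinarith
    · rcases eq_or_ne Ba m with hBa | hBa
      · linarith [h.swap_left.one_occupied_of_full hmb hBa hδ]
      · linarith [h.swap_left.one_occupied_of_pos (by linarith)
          (by have := h.hab; omega)]
  · rcases eq_or_ne Ab m with hAb | hAb
    · linarith [h.one_occupied_of_full hma hAb hδ]
    · linarith [h.one_occupied_of_pos (by linarith) (by have := h.hab; have := h.nonneg_b; omega)]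

theorem one_occupied_pos_of_left (h : NodeBounds m ma mb mc Ab Ac Ba Bc Ca Cb Sa Sb Sc)
    (hr : 1 ≤ m - Ab - Ba) (ha : 1 ≤ ma) {δ : ℤ} (hδ : mc = 0 ∧ δ = 0 ∨ 1 ≤ mc ∧ δ = 1) :
    0 < m ^ 2 - Sa - Sb - Sc - (m - Bc - Cb) - (m - Ac - Ca) + 1 - δ := by
  have hpos := h.pos
  have hb := h.nonneg_b
  have ha : 1 ≤ ma ∧ ma ≤ Ab ∧ ma ≤ Ac := by
    rcases h.ha with ha' | ha'
    · linarith
    · exact ha'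
  rcases hδ with ⟨h0, rfl⟩ | ⟨h0, rfl⟩
  · linarith [h.one_occupied_of_pos (by linarith) (by linarith)]
  · rcases h.hc with hc | hc
    · linarith
    · have e0 := h.area_ge_of_pos (by linarith) (by linarith)
      have e1 := mul_nonneg (show 0 ≤ m - Ab - Ba by linarith) hb.2.2
      have e2 : 0 < (m - Ab) * Cb * (m - Ca) :=
        mul_pos (mul_pos (by linarith) (by linarith)) (by linarith [h.hac])
      have e3 := mul_nonneg (mul_nonneg (show 0 ≤ Ab by linarith) (show 0 ≤ Ca by linarith))
        (show 0 ≤ m - Cb by linarith [h.hbc])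
      have e4 : 0 < (m - Ab) * Cb + Ab * Ca - Ca * Cb := by
        refine pos_of_mul_pos_right (a := m) ?_ (by linarith)
        linarith
      linarith

theorem one_occupied_pos (h : NodeBounds m ma mb mc Ab Ac Ba Bc Ca Cb Sa Sb Sc)
    (hm : 2 ≤ m) (hr : 1 ≤ m - Ab - Ba) (hD : 0 < m ^ 2 - Sa - Sb - Sc) {δ : ℤ}
    (hδ : mc = 0 ∧ δ = 0 ∨ 1 ≤ mc ∧ δ = 1) :
    0 < m ^ 2 - Sa - Sb - Sc - (m - Bc - Cb) - (m - Ac - Ca) + 1 - δ := by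
  rcases h.ha with ⟨-, hAb, hAc, hSa⟩ | ha
  · rcases h.hb with ⟨-, hBa, hBc, hSb⟩ | hb
    · rcases hδ with ⟨h0, rfl⟩ | ⟨h0, rfl⟩
      · rcases h.hc with ⟨-, hCa, hCb, hSc⟩ | hc
        · nlinarith
        · linarith
      · rcases h.hc with hc | hc
        · linarith
        · have h1 := h.hac
          have h2 := h.hbc
          have h3 := h.sc
          rcases eq_or_ne Ca m with e | e <;> rcases eq_or_ne Cb m with e' | e'
          · linarith
          · have h4 : Cb ≤ m - 1 := by omega
            nlinarith
          · have h4 : Ca ≤ m - 1 := by omega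
            nlinarith
          · have h4 : Cb ≤ m - 1 := by omega
            have h5 : Ca ≤ m - 1 := by omega
            have e1 : (Ca - 1) * (Cb - 1) ≤ (m - 2) * (m - 2) :=
              mul_le_mul (by linarith) (by linarith) (by linarith) (by linarith)
            nlinarith
    · linarith [h.swap_left.one_occupied_pos_of_left (by linarith) hb.1 hδ]
  · exact h.one_occupied_pos_of_left hr ha.1 hδ

theorem none_occupied_two (h : NodeBounds m ma mb mc Ab Ac Ba Bc Ca Cb Sa Sb Sc)
    (ha : 1 ≤ ma) (hb : 1 ≤ mb) :
    0 ≤ m ^ 2 - Sa - Sb - Sc - (m - Bc - Cb) - (m - Ac - Ca) - (m - Ab - Ba) := by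
  have ha' : ma ≤ Ab ∧ ma ≤ Ac := by
    rcases h.ha with h' | h'
    · linarith
    · exact h'.2
  have hb' : mb ≤ Ba ∧ mb ≤ Bc := by
    rcases h.hb with h' | h'
    · linarith
    · exact h'.2
  have := mul_nonneg (show 0 ≤ m - Ab - Ba by linarith [h.hab]) (show 0 ≤ Bc - 1 by linarith)
  have := h.area_ge_of_pos (by linarith) (by linarith [h.hab])
  linarith [h.bracket_nonneg]

theorem none_occupied_one (h : NodeBounds m ma mb mc Ab Ac Ba Bc Ca Cb Sa Sb Sc)
    (ha : ma = 0) (hb : mb = 0) (hc : mc < m) :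
    0 ≤ m ^ 2 - Sa - Sb - Sc - (m - Bc - Cb) - (m - Ac - Ca) - (m - Ab - Ba) + 2 := by
  have hpos := h.pos
  have h1 := h.hac
  have h2 := h.hbc
  have h3 := h.sc
  obtain ⟨-, hAb, hAc, hSa⟩ : ma = 0 ∧ Ab = 0 ∧ Ac = 0 ∧ Sa = 0 := by
    rcases h.ha with h' | h'
    · exact h'
    · linarith
  obtain ⟨-, hBa, hBc, hSb⟩ : mb = 0 ∧ Ba = 0 ∧ Bc = 0 ∧ Sb = 0 := by
    rcases h.hb with h' | h'
    · exact h'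
    · linarith
  rcases h.hc with ⟨-, hCa, hCb, hSc⟩ | hc'
  · rcases eq_or_lt_of_le hpos with e | e
    · subst e
      linarith
    · have := mul_nonneg (show 0 ≤ m - 1 by linarith) (show 0 ≤ m - 2 by linarith)
      linarith
  have hS : Sc ≤ mc * m := by
    rcases h.sc' with h6 | h6
    · exact h6.trans (mul_le_mul_of_nonneg_left (by linarith) (by linarith))
    · exact h6.trans (mul_le_mul_of_nonneg_left (by linarith) (by linarith))
  have e1 := mul_nonneg (show 0 ≤ m - 1 by linarith) (show 0 ≤ m - mc - 1 by linarith)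
  rcases eq_or_ne Ca m with e | e
  · nlinarith
  rcases eq_or_ne Cb m with e' | e'
  · nlinarith
  have h4 : Cb ≤ m - 1 := by omega
  have h5 : Ca ≤ m - 1 := by omega
  have e1 : (Ca - 1) * (Cb - 1) ≤ (m - 2) * (m - 2) :=
    mul_le_mul (by linarith) (by linarith) (by linarith) (by linarith)
  nlinarith

theorem none_occupied_nonneg (h : NodeBounds m ma mb mc Ab Ac Ba Bc Ca Cb Sa Sb Sc)
    (hma : ma < m) (hmb : mb < m) (hmc : mc < m) {δa δb δc : ℤ}
    (hδa : ma = 0 ∧ δa = 0 ∨ 1 ≤ ma ∧ δa = 1) (hδb : mb = 0 ∧ δb = 0 ∨ 1 ≤ mb ∧ δb = 1)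
    (hδc : mc = 0 ∧ δc = 0 ∨ 1 ≤ mc ∧ δc = 1) :
    0 ≤ m ^ 2 - Sa - Sb - Sc - (m - Bc - Cb) - (m - Ac - Ca) - (m - Ab - Ba)
      + (3 - δa - δb - δc) := by
  rcases hδa with ⟨h1, rfl⟩ | ⟨h1, rfl⟩ <;> rcases hδb with ⟨h2, rfl⟩ | ⟨h2, rfl⟩ <;>
    rcases hδc with ⟨h3, rfl⟩ | ⟨h3, rfl⟩
  · linarith [h.none_occupied_one h1 h2 hmc]
  · linarith [h.none_occupied_one h1 h2 hmc]
  · linarith [h.swap_right.none_occupied_one h1 h3 hmb]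
  · linarith [h.swap_right.swap_left.swap_right.none_occupied_two h3 h2]
  · linarith [h.swap_left.swap_right.none_occupied_one h2 h3 hma]
  · linarith [h.swap_right.none_occupied_two h1 h3]
  · linarith [h.none_occupied_two h1 h2]
  · linarith [h.none_occupied_two h1 h2]

theorem only_child (h : NodeBounds m ma mb mc Ab Ac Ba Bc Ca Cb Sa Sb Sc) (hma : ma = m) :
    mb = 0 ∧ mc = 0 ∧ Ab = m ∧ Ac = m ∧ Ba = 0 ∧ Bc = 0 ∧ Ca = 0 ∧ Cb = 0 ∧ Sb = 0 ∧ Sc = 0 := by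
  have hpos := h.pos
  have h1 := h.hab
  have h2 := h.hac
  have ha' : ma ≤ Ab ∧ ma ≤ Ac := by
    rcases h.ha with h' | h'
    · linarith
    · exact h'.2
  obtain ⟨h3, h4, h5, h6⟩ : mb = 0 ∧ Ba = 0 ∧ Bc = 0 ∧ Sb = 0 := by
    rcases h.hb with h' | h'
    · exact h'
    · linarith
  obtain ⟨h7, h8, h9, h10⟩ : mc = 0 ∧ Ca = 0 ∧ Cb = 0 ∧ Sc = 0 := by
    rcases h.hc with h' | h'
    · exact h'
    · linarith
  refine ⟨h3, h7, ?_, ?_, h4, h5, h8, h9, h6, h10⟩ <;> linarith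

end NodeBounds

namespace ToricCluster

open ToricConstellation

variable {r : ℕ} {A : ToricCluster r}

variable (A) in
/-- The weight of the child along `x` (`0` if it is missing). -/
noncomputable def childWeight (i : Fin r) (x : Fin 3) : ℤ := (A.ch i x).elim 0 A.m

variable (A) in
/-- The number of children along `x`. -/
noncomputable def childCount (i : Fin r) (x : Fin 3) : ℤ := (A.ch i x).elim 0 fun _ => 1

variable (A) in
/-- The sum of the squares of the weights of the nodes having `i` as entry number `x`. -/
noncomputable def sqSum (i : Fin r) (x : Fin 3) : ℤ :=
  A.descSum {x}ᶜ (fun j => A.m j ^ 2) (A.ch i x)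

theorem D_eq {a b c : Fin 3} (hab : a ≠ b) (hac : a ≠ c) (hbc : b ≠ c) (i : Fin r) :
    A.D i = A.m i ^ 2 - A.sqSum i a - A.sqSum i b - A.sqSum i c := by
  rw [D, sum_proxSet, Fin3.sum_eq hab hac hbc, sum_slot_eq, sum_slot_eq, sum_slot_eq]
  simp only [sqSum]
  ring

theorem childCount_cases (i : Fin r) (x : Fin 3) :
    A.childWeight i x = 0 ∧ A.childCount i x = 0 ∨
      1 ≤ A.childWeight i x ∧ A.childCount i x = 1 := by
  unfold childWeight childCount
  cases A.ch i x with
  | none => simp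
  | some k => exact Or.inr ⟨A.m_pos k, rfl⟩

theorem ch_of_childWeight {i : Fin r} {x : Fin 3} (h : A.childWeight i x ≠ 0) :
    ∃ k, A.ch i x = some k ∧ A.m k = A.childWeight i x := by
  unfold childWeight at *
  cases hk : A.ch i x with
  | none => simp [hk] at h
  | some k => exact ⟨k, rfl, rfl⟩

theorem childWeight_some {i k : Fin r} {x : Fin 3} (h : A.ch i x = some k) :
    A.childWeight i x = A.m k := by
  simp [childWeight, h]

theorem ch_none_of_childWeight {i : Fin r} {x : Fin 3} (h : A.childWeight i x = 0) :
    A.ch i x = none := by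
  cases hk : A.ch i x with
  | none => rfl
  | some k =>
    rw [childWeight_some hk] at h
    exact absurd h (A.m_pos k).ne'

theorem sqSum_le (hA : A.Idealistic) {a b c : Fin 3} (hab : a ≠ b) (hac : a ≠ c) (hbc : b ≠ c)
    (n : Fin r) :
    A.descSum {a}ᶜ (fun j => A.m j ^ 2) (some n) ≤ A.m n ^ 2 + A.M n b b * A.M n b c
      + A.M n c b * A.M n c c ∧
    A.descSum {a}ᶜ (fun j => A.m j ^ 2) (some n) ≤ (A.m n + A.M n b b) * (A.m n + A.M n c c) := by
  induction n using ch_induction (C := A.toToricConstellation) with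
  | h n ih =>
    have step : ∀ x, A.descSum {a}ᶜ (fun j => A.m j ^ 2) (A.ch n x) ≤ A.M n x b * A.M n x c := by
      intro x
      cases hx : A.ch n x with
      | none => simp [M_none hx, descSum_none]
      | some k =>
        rw [M_some hx, M_some hx]
        exact (ih x k hx).2
    have h1 : A.descSum {a}ᶜ (fun j => A.m j ^ 2) (some n) ≤ A.m n ^ 2 + A.M n b b * A.M n b c
        + A.M n c b * A.M n c c := by
      rw [descSum_some, Fin3.compl_eq hab hac hbc, sum_pair hbc, ← Fin3.compl_eq hab hac hbc]
      linarith [step b, step c]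
    refine ⟨h1, h1.trans ?_⟩
    have h2 := hA n b c hbc
    have e1 := mul_nonneg (M_nonneg (A := A) n b b)
      (show 0 ≤ A.m n - A.M n b c by linarith [M_nonneg (A := A) n c b])
    have e2 := mul_nonneg (M_nonneg (A := A) n c c)
      (show 0 ≤ A.m n - A.M n c b by linarith [M_nonneg (A := A) n b c])
    have e3 := mul_nonneg (M_nonneg (A := A) n b b) (M_nonneg (A := A) n c c)
    linarith

theorem nodeBounds (hA : A.Idealistic) {a b c : Fin 3} (hab : a ≠ b) (hac : a ≠ c) (hbc : b ≠ c)
    (i : Fin r) :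
    NodeBounds (A.m i) (A.childWeight i a) (A.childWeight i b) (A.childWeight i c)
      (A.M i a b) (A.M i a c) (A.M i b a) (A.M i b c) (A.M i c a) (A.M i c b)
      (A.sqSum i a) (A.sqSum i b) (A.sqSum i c) := by
  have h1 : ∀ x y z, (A.childWeight i x = 0 ∧ A.M i x y = 0 ∧ A.M i x z = 0 ∧ A.sqSum i x = 0) ∨
      (1 ≤ A.childWeight i x ∧ A.childWeight i x ≤ A.M i x y ∧ A.childWeight i x ≤ A.M i x z) := by
    intro x y z
    unfold childWeight sqSum
    cases hx : A.ch i x with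
    | none => simp [M_none hx, descSum_none]
    | some k =>
      rw [M_some hx, M_some hx]
      exact Or.inr ⟨A.m_pos k, le_add_of_nonneg_right (M_nonneg _ _ _),
        le_add_of_nonneg_right (M_nonneg _ _ _)⟩
  have h2 : ∀ {x y z : Fin 3}, x ≠ y → x ≠ z → y ≠ z → A.sqSum i x ≤ A.M i x y * A.M i x z := by
    intro x y z hxy hxz hyz
    unfold sqSum
    cases hx : A.ch i x with
    | none => simp [M_none hx, descSum_none]
    | some k =>
      rw [M_some hx, M_some hx]
      exact (sqSum_le hA hxy hxz hyz k).2
  have h3 : ∀ {x y z : Fin 3}, x ≠ y → x ≠ z → y ≠ z →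
      A.sqSum i x ≤ A.childWeight i x * A.M i x y ∨
        A.sqSum i x ≤ A.childWeight i x * A.M i x z := by
    intro x y z hxy hxz hyz
    unfold sqSum childWeight
    cases hx : A.ch i x with
    | none => simp [descSum_none]
    | some k =>
      rw [M_some hx, M_some hx]
      simp only [Option.elim_some]
      have e1 := (sqSum_le hA hxy hxz hyz k).1
      have e2 := hA k y z hyz
      have p1 := M_nonneg (A := A) k y z
      have p2 := M_nonneg (A := A) k z y
      rcases le_total (A.M k y y) (A.M k z z) with h | h
      · right
        have := mul_le_mul_of_nonneg_right h p1
        have := mul_le_mul_of_nonneg_right e2 (M_nonneg (A := A) k z z)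
        linarith
      · left
        have := mul_le_mul_of_nonneg_right h p2
        have := mul_le_mul_of_nonneg_right e2 (M_nonneg (A := A) k y y)
        linarith
  exact
    { pos := A.m_pos i
      hab := hA i a b hab
      hac := hA i a c hac
      hbc := hA i b c hbc
      ha := h1 a b c
      hb := h1 b a c
      hc := h1 c a b
      sa := h2 hab hac hbc
      sb := h2 hab.symm hbc hac
      sc := h2 hac.symm hbc.symm hab
      sa' := h3 hab hac hbc
      sb' := h3 hab.symm hbc hac
      sc' := h3 hac.symm hbc.symm hab }

/-! ### The term `T` -/

theorem isChild_iff {i k : Fin r} : A.IsChild k i ↔ ∃ x, A.ch i x = some k := by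
  simp only [IsChild, ch_eq_some]
  exact ⟨fun h => ⟨_, h.1, h.2, rfl⟩, fun ⟨x, h1, h2, _⟩ => ⟨h1, h2⟩⟩

open Classical in
theorem card_children (s : Finset (Fin r)) (i : Fin r) (P : Fin 3 → Prop)
    (h : ∀ k, k ∈ s ↔ ∃ x, A.ch i x = some k ∧ P x) :
    (s.card : ℤ) = ∑ x, if P x then A.childCount i x else 0 := by
  have hs : s = univ.biUnion fun x => if P x then (A.ch i x).toFinset else ∅ := by
    ext k
    rw [h]
    simp only [mem_biUnion, mem_univ, true_and]
    refine exists_congr fun x => ?_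
    split_ifs with hx <;> simp [hx, eq_comm]
  rw [hs, card_biUnion]
  · rw [Nat.cast_sum]
    refine sum_congr rfl fun x _ => ?_
    split_ifs
    · unfold childCount
      cases A.ch i x <;> simp
    · simp
  · intro x _ y _ hxy
    rw [Function.onFun, disjoint_left]
    intro k hx hy
    split_ifs at hx hy
    · rw [Option.mem_toFinset] at hx hy
      exact hxy ((ch_eq_some.1 hx).2.2.symm.trans (ch_eq_some.1 hy).2.2)
    all_goals simp_all

theorem mem_Aset {i k : Fin r} :
    k ∈ A.Aset i ↔ ∃ x, A.ch i x = some k ∧ ∀ a, a ≠ x → A.slot i a = none := by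
  simp only [Aset, mem_filter, mem_univ, true_and, isChild_iff, prox_iff]
  constructor
  · rintro ⟨⟨x, hx⟩, h⟩
    refine ⟨x, hx, fun a ha => ?_⟩
    cases hl : A.slot i a with
    | none => rfl
    | some l => exact absurd ⟨l, ⟨a, hl⟩, a, by rw [slot_ch_of_ne hx ha, hl]⟩ h
  · rintro ⟨x, hx, h⟩
    refine ⟨⟨x, hx⟩, ?_⟩
    rintro ⟨l, ⟨a, ha⟩, b, hb⟩
    rcases eq_or_ne b x with rfl | hbx
    · rw [slot_ch_self hx] at hb
      cases hb
      exact absurd (slot_lt ha) (lt_irrefl _)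
    · rw [slot_ch_of_ne hx hbx, h b hbx] at hb
      cases hb

theorem card_Bset {a b c : Fin 3} (hab : a ≠ b) (hac : a ≠ c) (hbc : b ≠ c) (i : Fin r) :
    (A.Bset i).card = (A.slot i a).elim 0 (fun _ => 1) + (A.slot i b).elim 0 (fun _ => 1)
      + (A.slot i c).elim 0 fun _ => 1 := by
  rw [card_eq_sum_ones, sum_Bset, Fin3.sum_eq hab hac hbc]

theorem T_zero {a b c : Fin 3} (hab : a ≠ b) (hac : a ≠ c) (hbc : b ≠ c) {i : Fin r}
    (ha : A.slot i a = none) (hb : A.slot i b = none) (hc : A.slot i c = none) :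
    A.T i = 3 - A.childCount i a - A.childCount i b - A.childCount i c := by
  classical
  have h : ∀ x, ∀ y, y ≠ x → A.slot i y = none := by
    intro x y _
    rcases Fin3.eq_or hab hac hbc y with rfl | rfl | rfl <;> assumption
  rw [T, card_children (A.Aset i) i _ fun k => mem_Aset, card_Bset hab hac hbc, ha, hb, hc,
    Fin3.sum_eq hab hac hbc, if_pos (h a), if_pos (h b), if_pos (h c)]
  simp
  ring

theorem T_one {a b c : Fin 3} (hab : a ≠ b) (hac : a ≠ c) (hbc : b ≠ c) {i : Fin r}
    (ha : A.slot i a = none) (hb : A.slot i b = none) (hc : A.slot i c ≠ none) :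
    A.T i = 1 - A.childCount i c := by
  classical
  obtain ⟨j, hj⟩ := Option.ne_none_iff_exists'.1 hc
  have h : ∀ y, y ≠ c → A.slot i y = none := by
    intro y hy
    rcases Fin3.eq_or hab hac hbc y with rfl | rfl | rfl
    · exact ha
    · exact hb
    · exact absurd rfl hy
  rw [T, card_children (A.Aset i) i _ fun k => mem_Aset, card_Bset hab hac hbc, ha, hb, hj,
    Fin3.sum_eq hab hac hbc, if_neg fun h => hc (h c hac.symm), if_neg fun h => hc (h c hbc.symm),
    if_pos h]
  simp
  ring

theorem T_two {a b c : Fin 3} (hab : a ≠ b) (hac : a ≠ c) (hbc : b ≠ c) {i : Fin r}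
    (hb : A.slot i b ≠ none) (hc : A.slot i c ≠ none) : A.T i = 0 := by
  classical
  obtain ⟨j, hj⟩ := Option.ne_none_iff_exists'.1 hc
  obtain ⟨k, hk⟩ := Option.ne_none_iff_exists'.1 hb
  rw [T, card_children (A.Aset i) i _ fun k => mem_Aset, card_Bset hab hac hbc, hk, hj,
    Fin3.sum_eq hab hac hbc, if_neg fun h => hc (h c hac.symm), if_neg fun h => hc (h c hbc.symm),
    if_neg fun h => hb (h b hbc)]
  cases A.slot i a <;> simp

end ToricCluster

namespace ToricCluster

open ToricConstellation

variable {r : ℕ} {A : ToricCluster r}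

/-! ### Signs of the Euler characteristics -/

variable (A) in
/-- Some child of `i`, along a label whose entry in the cone is a basis vector, has the weight
of `i`. -/
def Full (i : Fin r) : Prop := ∃ x, A.slot i x = none ∧ A.childWeight i x = A.m i

theorem slot_pattern (i : Fin r) : ∃ a b c : Fin 3, a ≠ b ∧ a ≠ c ∧ b ≠ c ∧
    (A.slot i a = none ∧ A.slot i b = none ∧ A.slot i c = none ∨
      A.slot i a = none ∧ A.slot i b = none ∧ A.slot i c ≠ none ∨
      A.slot i a = none ∧ A.slot i b ≠ none ∧ A.slot i c ≠ none ∨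
      A.slot i a ≠ none ∧ A.slot i b ≠ none ∧ A.slot i c ≠ none) := by
  have h01 : (0 : Fin 3) ≠ 1 := by decide
  have h02 : (0 : Fin 3) ≠ 2 := by decide
  have h12 : (1 : Fin 3) ≠ 2 := by decide
  by_cases h0 : A.slot i 0 = none <;> by_cases h1 : A.slot i 1 = none <;>
    by_cases h2 : A.slot i 2 = none
  · exact ⟨0, 1, 2, h01, h02, h12, by tauto⟩
  · exact ⟨0, 1, 2, h01, h02, h12, by tauto⟩
  · exact ⟨0, 2, 1, h02, h01, h12.symm, by tauto⟩
  · exact ⟨0, 1, 2, h01, h02, h12, by tauto⟩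
  · exact ⟨1, 2, 0, h12, h01.symm, h02.symm, by tauto⟩
  · exact ⟨1, 0, 2, h01.symm, h12, h02, by tauto⟩
  · exact ⟨2, 0, 1, h02.symm, h12.symm, h01, by tauto⟩
  · exact ⟨0, 1, 2, h01, h02, h12, by tauto⟩

theorem chi_nonneg (hA : A.Idealistic) {i : Fin r} (hi : ¬ A.Full i) : 0 ≤ A.chi i := by
  obtain ⟨a, b, c, hab, hac, hbc, h⟩ := slot_pattern (A := A) i
  have B := nodeBounds hA hab hac hbc i
  have lt_a : A.slot i a = none → A.childWeight i a < A.m i := fun h =>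
    lt_of_le_of_ne B.child_le fun h' => hi ⟨a, h, h'⟩
  have lt_b : A.slot i b = none → A.childWeight i b < A.m i := fun h =>
    lt_of_le_of_ne B.swap_left.child_le fun h' => hi ⟨b, h, h'⟩
  have lt_c : A.slot i c = none → A.childWeight i c < A.m i := fun h =>
    lt_of_le_of_ne B.swap_right.swap_left.child_le fun h' => hi ⟨c, h, h'⟩
  rw [chi_eq hab hac hbc, D_eq hab hac hbc]
  rcases h with ⟨ha, hb, hc⟩ | ⟨ha, hb, hc⟩ | ⟨ha, hb, hc⟩ | ⟨ha, hb, hc⟩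
  · rw [T_zero hab hac hbc ha hb hc, if_pos ha, if_pos hb, if_pos hc]
    have := B.none_occupied_nonneg (lt_a ha) (lt_b hb) (lt_c hc) (childCount_cases i a)
      (childCount_cases i b) (childCount_cases i c)
    simp only [rab]
    linarith
  · rw [T_one hab hac hbc ha hb hc, if_pos ha, if_pos hb, if_neg hc]
    have := B.one_occupied_nonneg (lt_a ha) (lt_b hb) (childCount_cases i c)
    simp only [rab]
    linarith
  · rw [T_two hab hac hbc hb hc, if_pos ha, if_neg hb, if_neg hc]
    have h1 := B.defect_mul_le
    have h2 := mul_nonneg (show 0 ≤ A.m i - A.M i b c - A.M i c b by linarith [hA i b c hbc])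
      (show 0 ≤ A.m i - A.childWeight i a - 1 by linarith [lt_a ha])
    simp only [rab]
    linarith
  · rw [T_two hab hac hbc hb hc, if_neg ha, if_neg hb, if_neg hc]
    linarith [B.area_nonneg]

variable (A) in
/-- `Run x k e`: the node `e` is reached from `k` by at least one edge, all edges being labelled
`x` and all the nodes having the same weight. -/
inductive Run (x : Fin 3) (k : Fin r) : Fin r → Prop
  | single {e : Fin r} (h : A.ch k x = some e) (hm : A.m e = A.m k) : Run x k e
  | tail {p e : Fin r} (hp : Run x k p) (h : A.ch p x = some e) (hm : A.m e = A.m p) : Run x k e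

namespace Run

variable {x : Fin 3} {k e : Fin r}

theorem m_eq (h : A.Run x k e) : A.m e = A.m k := by
  induction h with
  | single _ hm => exact hm
  | tail _ _ hm ih => exact hm.trans ih

theorem last (h : A.Run x k e) : ∃ p, A.ch p x = some e := by
  cases h with
  | single h => exact ⟨_, h⟩
  | tail _ h => exact ⟨_, h⟩

theorem desc (h : A.Run x k e) : A.Desc {x} k e := by
  induction h with
  | single h => exact (Desc.refl k).tail h (mem_singleton_self x)
  | tail _ h _ ih => exact ih.tail h (mem_singleton_self x)

theorem slot_self (h : A.Run x k e) : A.slot e x ≠ none := by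
  obtain ⟨p, hp⟩ := h.last
  simp [slot_ch_self hp]

theorem slot_of_ne (h : A.Run x k e) {y : Fin 3} (hy : y ≠ x) : A.slot e y = A.slot k y :=
  h.desc.slot_of_notMem (by simpa using hy)

theorem ch_of_ne (hA : A.Idealistic) (h : A.Run x k e) {y : Fin 3} (hy : y ≠ x) :
    A.ch e y = none := by
  have key : ∀ {p q : Fin r}, A.ch p x = some q → A.m q = A.m p → A.ch q y = none := by
    intro p q hq hm
    apply ch_eq_none_of_M (b := y)
    have h1 := hA p x y hy.symm
    rw [M_some hq] at h1
    linarith [M_nonneg (A := A) p y x]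
  cases h with
  | single h hm => exact key h hm
  | tail _ h hm => exact key h hm

theorem data (h : A.Run x k e) (hx : A.slot k x = none) :
    ∃ t : ℤ, 1 ≤ t ∧ A.N e = (t + 1) * A.N k ∧ A.nu e = (t + 1) * A.nu k - t := by
  have step : ∀ {p q : Fin r}, A.ch p x = some q → (∀ y, y ≠ x → A.slot p y = A.slot k y) →
      A.m q = A.m k → A.N q = A.N p + A.N k ∧ A.nu q = A.nu p + A.nu k - 1 := by
    intro p q hq hs hm
    obtain ⟨y, z, hxy, hxz, hyz⟩ := Fin3.exists_others x
    rw [N_eq q, nu_eq q, N_eq k, nu_eq k, Fin3.sum_eq hxy hxz hyz, Fin3.sum_eq hxy hxz hyz,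
      Fin3.sum_eq hxy hxz hyz, Fin3.sum_eq hxy hxz hyz, slot_ch_self hq,
      slot_ch_of_ne hq hxy.symm, slot_ch_of_ne hq hxz.symm, hs y hxy.symm, hs z hxz.symm, hm, hx]
    simp only [Option.elim_some, Option.elim_none]
    constructor <;> ring
  induction h with
  | single h hm =>
    obtain ⟨h1, h2⟩ := step h (fun _ _ => rfl) hm
    exact ⟨1, le_rfl, by rw [h1]; ring, by rw [h2]; ring⟩
  | tail hp h hm ih =>
    obtain ⟨t, ht, h3, h4⟩ := ih
    obtain ⟨h1, h2⟩ := step h (fun y hy => hp.slot_of_ne hy) (hm.trans hp.m_eq)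
    exact ⟨t + 1, by linarith, by rw [h1, h3]; ring, by rw [h2, h4]; ring⟩

theorem start_unique {x' : Fin 3} {k' : Fin r} (h : A.Run x k e) (h' : A.Run x' k' e)
    (hx : A.slot k x = none) (hx' : A.slot k' x' = none) : k = k' := by
  obtain ⟨p, hp⟩ := h.last
  obtain ⟨p', hp'⟩ := h'.last
  obtain rfl : x = x' := (ch_eq_some.1 hp).2.2.symm.trans (ch_eq_some.1 hp').2.2
  have key : ∀ {k k' : Fin r}, A.slot k' x = none → A.Desc {x} k k' → k = k' := by
    intro k k' hk hd
    rcases desc_iff_tail.1 hd with rfl | ⟨y, hy, q, hq, -⟩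
    · rfl
    · rw [mem_singleton] at hy
      subst hy
      rw [slot_ch_self hq] at hk
      cases hk
  rcases h.desc.comparable h'.desc with hd | hd
  · exact key hx' hd
  · exact (key hx hd).symm

end Run

theorem Full.exists_end (hA : A.Idealistic) {k : Fin r} (hk : A.Full k) :
    ∃ x e, A.slot k x = none ∧ A.childWeight k x = A.m k ∧ A.Run x k e ∧
      A.childWeight e x < A.m e := by
  obtain ⟨x, hx, hm⟩ := hk
  have key : ∀ p, A.Run x k p → ∃ e, A.Run x k e ∧ A.childWeight e x < A.m e := by
    intro p
    induction p using ch_induction (C := A.toToricConstellation) with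
    | h n ih =>
      intro hn
      obtain ⟨y, z, hxy, hxz, hyz⟩ := Fin3.exists_others x
      rcases lt_or_eq_of_le (nodeBounds hA hxy hxz hyz n).child_le with h | h
      · exact ⟨n, hn, h⟩
      · obtain ⟨q, hq, hqm⟩ := ch_of_childWeight (by rw [h]; exact (A.m_pos n).ne')
        exact ih x q hq (hn.tail hq (hqm.trans h))
  obtain ⟨q, hq, hqm⟩ := ch_of_childWeight (by rw [hm]; exact (A.m_pos k).ne')
  obtain ⟨e, he, hlt⟩ := key q (Run.single hq (hqm.trans hm))
  exact ⟨x, e, hx, hm, he, hlt⟩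

theorem not_full_of_run (hA : A.Idealistic) {x : Fin 3} {k e : Fin r} (h : A.Run x k e)
    (hlt : A.childWeight e x < A.m e) : ¬ A.Full e := by
  rintro ⟨y, hy, hm⟩
  rcases eq_or_ne y x with rfl | hyx
  · exact hlt.ne hm
  · rw [childWeight, h.ch_of_ne hA hyx, Option.elim_none] at hm
    exact (A.m_pos e).ne hm

theorem chi_add_chi_nonneg (hA : A.Idealistic) {x : Fin 3} {k e : Fin r} (hx : A.slot k x = none)
    (hm : A.childWeight k x = A.m k) (h : A.Run x k e) (hlt : A.childWeight e x < A.m e) :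
    0 ≤ A.chi k + A.chi e := by
  obtain ⟨y, z, hxy, hxz, hyz⟩ := Fin3.exists_others x
  have Bk := nodeBounds hA hxy hxz hyz k
  have Be := nodeBounds hA hxy hxz hyz e
  obtain ⟨k1, k2, k3, k4, k5, k6, k7, k8, -, -⟩ := Bk.only_child hm
  have cy := h.ch_of_ne hA hxy.symm
  have cz := h.ch_of_ne hA hxz.symm
  have d1 := Bk.area_nonneg
  have d2 := Be.defect_mul_le
  rw [M_none cy, M_none cz] at d2
  have cx := childCount_cases (A := A) k x
  have cy' : A.childCount k y = 0 := by
    rcases childCount_cases (A := A) k y with h' | h'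
    · exact h'.2
    · omega
  have cz' : A.childCount k z = 0 := by
    rcases childCount_cases (A := A) k z with h' | h'
    · exact h'.2
    · omega
  have hmk := A.m_pos k
  have cx' : A.childCount k x = 1 := by
    rcases cx with h' | h'
    · omega
    · exact h'.2
  have ha := Be.ha
  have hm' := h.m_eq
  have hwy : A.childWeight e x ≤ A.M e x y ∧ A.childWeight e x ≤ A.M e x z := by
    rcases ha with h' | h'
    · omega
    · exact h'.2
  have hw := Be.nonneg_a.1
  rw [chi_eq hxy hxz hyz, chi_eq hxy hxz hyz, D_eq hxy hxz hyz, D_eq hxy hxz hyz, if_pos hx,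
    if_neg h.slot_self, h.slot_of_ne hxy.symm, h.slot_of_ne hxz.symm]
  simp only [rab, M_none cy, M_none cz, k3, k4, k5, k6, k7, k8]
  rw [← hm'] at d1 ⊢
  have hce := childCount_cases (A := A) e x
  by_cases hy : A.slot k y = none <;> by_cases hz : A.slot k z = none
  · rw [T_zero hxy hxz hyz hx hy hz, T_one hyz hxy.symm hxz.symm
      ((h.slot_of_ne hxy.symm).trans hy) ((h.slot_of_ne hxz.symm).trans hz) h.slot_self,
      if_pos hy, if_pos hz, if_pos hy, if_pos hz, cx', cy', cz']
    rcases hce with ⟨e1, e2⟩ | ⟨e1, e2⟩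
    · have h3 : 0 ≤ (A.m e - 1) * (A.m e - 2) := by
        rcases (show A.m e = 1 ∨ 2 ≤ A.m e by omega) with h' | h'
        · simp [h']
        · exact mul_nonneg (by omega) (by omega)
      rw [e1] at d2 hwy
      rw [e2]
      nlinarith
    · have := mul_nonneg (show 0 ≤ A.m e - 2 by omega)
        (show 0 ≤ A.m e - A.childWeight e x - 1 by omega)
      rw [e2]
      nlinarith
  · rw [T_one hxy hxz hyz hx hy hz, T_two hyz hxy.symm hxz.symm
      (by rwa [h.slot_of_ne hxz.symm]) h.slot_self,
      if_pos hy, if_neg hz, if_pos hy, if_neg hz, cz']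
    have := mul_nonneg (show 0 ≤ A.m e - 1 by omega)
      (show 0 ≤ A.m e - A.childWeight e x - 1 by omega)
    nlinarith
  · rw [T_one hxz hxy hyz.symm hx hz hy, T_two hyz.symm hxz.symm hxy.symm
      (by rwa [h.slot_of_ne hxy.symm]) h.slot_self,
      if_neg hy, if_pos hz, if_neg hy, if_pos hz, cy']
    have := mul_nonneg (show 0 ≤ A.m e - 1 by omega)
      (show 0 ≤ A.m e - A.childWeight e x - 1 by omega)
    nlinarith
  · rw [T_two hxy hxz hyz hy hz, T_two hyz hxy.symm hxz.symm
      (by rwa [h.slot_of_ne hxz.symm]) h.slot_self,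
      if_neg hy, if_neg hz, if_neg hy, if_neg hz]
    have := mul_nonneg (show 0 ≤ A.m e by omega)
      (show 0 ≤ A.m e - A.childWeight e x - 1 by omega)
    nlinarith

/-- A node with positive Euler characteristic which is not compensated by the end of a run makes
the sum of the Euler characteristics over the nodes with `b ∣ N` positive. -/
theorem sum_chi_pos (hA : A.Idealistic) (b : ℤ) {j : Fin r} (hj : b ∣ A.N j) (hpos : 0 < A.chi j)
    (hfull : ¬ A.Full j)
    (hend : ∀ k x, b ∣ A.N k → A.slot k x = none → ¬ A.Run x k j) :
    0 < ∑ k with b ∣ A.N k, A.chi k := by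
  classical
  have hch : ∀ k : Fin r, ∃ e, A.Full k → ∃ x, A.slot k x = none ∧ A.childWeight k x = A.m k ∧
      A.Run x k e ∧ A.childWeight e x < A.m e := by
    intro k
    by_cases hk : A.Full k
    · obtain ⟨x, e, h⟩ := hk.exists_end hA
      exact ⟨e, fun _ => ⟨x, h⟩⟩
    · exact ⟨k, fun h => absurd h hk⟩
  choose e he using hch
  set S := univ.filter fun k => b ∣ A.N k
  set K := S.filter fun k => A.Full k
  have hinj : Set.InjOn e K := by
    intro k hk k' hk' hkk'
    obtain ⟨x, hx, -, hr, -⟩ := he k (mem_filter.1 hk).2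
    obtain ⟨x', hx', -, hr', -⟩ := he k' (mem_filter.1 hk').2
    rw [← hkk'] at hr'
    exact hr.start_unique hr' hx hx'
  have hjK : j ∉ K.image e := by
    rw [mem_image]
    rintro ⟨k, hk, rfl⟩
    obtain ⟨hkS, hkF⟩ := mem_filter.1 hk
    obtain ⟨x, hx, -, hr, -⟩ := he k hkF
    exact hend k x (mem_filter.1 hkS).2 hx hr
  have hsub : insert j (K.image e) ⊆ S.filter fun k => ¬ A.Full k := by
    intro l hl
    rw [mem_insert, mem_image] at hl
    simp only [S, mem_filter, mem_univ, true_and]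
    rcases hl with rfl | ⟨k, hk, rfl⟩
    · exact ⟨hj, hfull⟩
    · obtain ⟨hkS, hkF⟩ := mem_filter.1 hk
      obtain ⟨x, hx, -, hr, hlt⟩ := he k hkF
      obtain ⟨t, -, hN, -⟩ := hr.data hx
      exact ⟨hN ▸ (mem_filter.1 hkS).2.mul_left _, not_full_of_run hA hr hlt⟩
  have h1 : ∑ k ∈ insert j (K.image e), A.chi k ≤ ∑ k ∈ S.filter fun k => ¬ A.Full k, A.chi k :=
    sum_le_sum_of_subset_of_nonneg hsub fun k hk _ => chi_nonneg hA (mem_filter.1 hk).2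
  rw [sum_insert hjK, sum_image hinj] at h1
  have h2 : 0 ≤ ∑ k ∈ K, (A.chi k + A.chi (e k)) := by
    refine sum_nonneg fun k hk => ?_
    obtain ⟨x, hx, hm, hr, hlt⟩ := he k (mem_filter.1 hk).2
    exact chi_add_chi_nonneg hA hx hm hr hlt
  rw [sum_add_distrib] at h2
  rw [← sum_filter_add_sum_filter_not S fun k => A.Full k]
  linarith

end ToricCluster

namespace ToricCluster

open ToricConstellation

variable {r : ℕ} {A : ToricCluster r}

/-! ### Nodes contributing a given candidate pole -/

theorem _root_.Rat.den_dvd_of_eq_mul {ρ : ℚ} {w n : ℤ} (h : (w : ℚ) = ρ * n) :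
    (ρ.den : ℤ) ∣ n := by
  have h1 : w * ρ.den = ρ.num * n := by
    have h2 : (w : ℚ) * ρ.den = ρ.num * n := by
      rw [h, ← Rat.mul_den_eq_num ρ]
      ring
    exact_mod_cast h2
  have h2 : IsCoprime (ρ.den : ℤ) ρ.num := by
    rw [Int.isCoprime_iff_gcd_eq_one, Int.gcd_eq_natAbs, Int.natAbs_natCast, Nat.gcd_comm]
    exact ρ.reduced
  exact h2.dvd_of_dvd_mul_left ⟨w, by rw [← h1, mul_comm]⟩

variable (A) in
/-- The value of `N_i s + ν_i` at `s = -ρ`. -/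
def val (ρ : ℚ) (i : Fin r) : ℚ := A.nu i - ρ * A.N i

variable (A) in
/-- The value at `s = -ρ` of the linear factor of the node in a given entry of the cone of `i`;
basis vectors count as `1`. -/
def slotVal (ρ : ℚ) (i : Fin r) (x : Fin 3) : ℚ := (A.slot i x).elim 1 (A.val ρ)

variable {ρ : ℚ}

theorem slotVal_none {i : Fin r} {x : Fin 3} (h : A.slot i x = none) : A.slotVal ρ i x = 1 := by
  simp [slotVal, h]

theorem slotVal_some {i k : Fin r} {x : Fin 3} (h : A.slot i x = some k) :
    A.slotVal ρ i x = A.val ρ k := by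
  simp [slotVal, h]

theorem slotVal_ch_self {p k : Fin r} {x : Fin 3} (h : A.ch p x = some k) :
    A.slotVal ρ k x = A.val ρ p :=
  slotVal_some (slot_ch_self h)

theorem slotVal_ch_of_ne {p k : Fin r} {x y : Fin 3} (h : A.ch p x = some k) (hy : y ≠ x) :
    A.slotVal ρ k y = A.slotVal ρ p y := by
  rw [slotVal, slotVal, slot_ch_of_ne h hy]

theorem val_eq {x y z : Fin 3} (hxy : x ≠ y) (hxz : x ≠ z) (hyz : y ≠ z) (i : Fin r) :
    A.val ρ i = A.slotVal ρ i x + A.slotVal ρ i y + A.slotVal ρ i z - ρ * A.m i := by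
  have h : ∀ a, A.slotVal ρ i a =
      ((A.slot i a).elim 1 A.nu : ℤ) - ρ * ((A.slot i a).elim 0 A.N : ℤ) := by
    intro a
    cases h : A.slot i a with
    | none => simp [slotVal_none h]
    | some k => simp [slotVal_some h, val]
  rw [h, h, h, val, N_eq, nu_eq, Fin3.sum_eq hxy hxz hyz, Fin3.sum_eq hxy hxz hyz]
  push_cast
  ring

theorem den_dvd_N {i : Fin r} (h : A.val ρ i = 0) : (ρ.den : ℤ) ∣ A.N i :=
  Rat.den_dvd_of_eq_mul (sub_eq_zero.1 h)

theorem not_run_of_val_eq_zero {x : Fin 3} {k g : Fin r} (hg : A.val ρ g = 0)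
    (hk : (ρ.den : ℤ) ∣ A.N k) (hx : A.slot k x = none) : ¬ A.Run x k g := by
  intro h
  obtain ⟨t, ht, hN, hnu⟩ := h.data hx
  obtain ⟨n, hn⟩ := hk
  rw [val, hN, hnu, hn] at hg
  have h1 : t = (t + 1) * (A.nu k - ρ.num * n) := by
    have h2 : (t : ℚ) = (t + 1) * (A.nu k - ρ.num * n) := by
      rw [← Rat.mul_den_eq_num ρ]
      push_cast at hg
      linear_combination -hg
    exact_mod_cast h2
  have h2 : t + 1 ∣ t := ⟨_, h1⟩
  have := Int.le_of_dvd (by omega) h2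
  omega

theorem D_nonpos_of_childWeight (hA : A.Idealistic) {i : Fin r} {x : Fin 3}
    (h : A.childWeight i x = A.m i) : A.D i ≤ 0 := by
  obtain ⟨y, z, hxy, hxz, hyz⟩ := Fin3.exists_others x
  obtain ⟨-, -, -, -, -, -, -, -, h9, h10⟩ := (nodeBounds hA hxy hxz hyz i).only_child h
  obtain ⟨k, hk, hm⟩ := ch_of_childWeight (by rw [h]; exact (A.m_pos i).ne')
  have h1 : A.m k ^ 2 ≤ A.sqSum i x := by
    rw [sqSum, hk, descSum]
    exact single_le_sum (f := fun j => A.m j ^ 2) (fun j _ => sq_nonneg _)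
      (by simpa using Desc.refl k)
  rw [D_eq hxy hxz hyz, h9, h10]
  rw [hm, h] at h1
  linarith

theorem chi_nonpos_of_D_pos (hA : A.Idealistic)
    (hS : ∑ k with (ρ.den : ℤ) ∣ A.N k, A.chi k = 0) {j : Fin r} (hj : A.val ρ j = 0)
    (hD : 0 < A.D j) : A.chi j ≤ 0 := by
  by_contra! h
  refine (sum_chi_pos hA _ (den_dvd_N hj) h ?_ ?_).ne' hS
  · rintro ⟨x, -, hx⟩
    exact hD.not_ge (D_nonpos_of_childWeight hA hx)
  · exact fun k x hk hx => not_run_of_val_eq_zero hj hk hx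

theorem rab_comm (i : Fin r) (x y : Fin 3) : A.rab i x y = A.rab i y x := by
  unfold rab
  ring

/-- A node in a good pair whose remaining two directions leave some room. -/
theorem rab_eq_one (hA : A.Idealistic) (hρ : ρ.den ≠ 1)
    (hS : ∑ k with (ρ.den : ℤ) ∣ A.N k, A.chi k = 0) {s y z : Fin 3} (hsy : s ≠ y) (hsz : s ≠ z)
    (hyz : y ≠ z) (j i : Fin r) (hs : A.slot j s = some i) (hi : A.val ρ i = 0)
    (hj : A.val ρ j = 0) (hr : 0 < A.rab j y z) :
    A.rab j y z = 1 ∧ (A.slot j y = none ∧ A.ch j z = none ∨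
      A.slot j z = none ∧ A.ch j y = none) := by
  induction j using ch_induction (C := A.toToricConstellation) generalizing i with
  | h j ih =>
    have Bs := nodeBounds hA hsy hsz hyz j
    have hDeq := D_eq (A := A) hsy hsz hyz j
    have hv := val_eq (ρ := ρ) (A := A) hsy hsz hyz j
    rw [hj, slotVal_some hs, hi] at hv
    rcases le_or_gt (A.D j) 0 with hD | hD
    · have hm : A.childWeight j s = A.m j := by
        refine le_antisymm Bs.child_le ?_
        by_contra! hlt
        have h1 := Bs.defect_mul_le
        have h2 : 0 < A.rab j y z * (A.m j - A.childWeight j s) := mul_pos hr (by linarith)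
        rw [rab] at h2
        linarith
      obtain ⟨h1, h2, h3, h4, -⟩ := Bs.only_child hm
      obtain ⟨l, hl, hlm⟩ := ch_of_childWeight (by rw [hm]; exact (A.m_pos j).ne')
      rw [M_some hl] at h3 h4
      have cy : A.ch l y = none := ch_eq_none_of_M (b := y) (by linarith)
      have cz : A.ch l z = none := ch_eq_none_of_M (b := z) (by linarith)
      have cy' := ch_none_of_childWeight h1
      have cz' := ch_none_of_childWeight h2
      have hrl : A.rab l y z = A.rab j y z := by
        rw [rab, rab, M_none cy, M_none cz, M_none cy', M_none cz', hlm, hm]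
      have hl0 : A.val ρ l = 0 := by
        rw [val_eq hsy hsz hyz, slotVal_ch_self hl, slotVal_ch_of_ne hl hsy.symm,
          slotVal_ch_of_ne hl hsz.symm, hlm, hm, hj]
        linarith
      obtain ⟨h5, h6⟩ := ih s l hl j (slot_ch_self hl) hj hl0 (hrl ▸ hr)
      refine ⟨hrl ▸ h5, ?_⟩
      rw [slot_ch_of_ne hl hsy.symm, slot_ch_of_ne hl hsz.symm] at h6
      exact h6.imp (fun h => ⟨h.1, cz'⟩) fun h => ⟨h.1, cy'⟩
    · have hchi := chi_nonpos_of_D_pos hA hS hj hD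
      have hs' : A.slot j s ≠ none := by simp [hs]
      have key : ∀ {y z : Fin 3}, s ≠ y → s ≠ z → y ≠ z → 0 < A.rab j y z →
          A.slot j y = none → A.slot j z ≠ none → A.rab j y z = 1 ∧ A.ch j z = none := by
        intro y z hsy hsz hyz hr hy hz
        have B := nodeBounds hA hsy.symm hyz hsz j
        have h1 := B.defect_mul_le
        rw [← D_eq hsy.symm hyz hsz] at h1
        rw [chi_eq hsy.symm hyz hsz, T_two hsy.symm hyz hsz hs' hz, if_pos hy, if_neg hs',
          if_neg hz] at hchi
        have h2 : A.childWeight j y < A.m j := lt_of_le_of_ne B.child_le fun h =>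
          hD.not_ge (D_nonpos_of_childWeight hA h)
        have h3 : A.childWeight j y = A.m j - 1 := by
          by_contra h
          have h4 := mul_le_mul_of_nonneg_left (show 2 ≤ A.m j - A.childWeight j y by omega)
            (show 0 ≤ A.rab j s z by linarith)
          rw [rab] at h4 hchi
          linarith
        have h4 : A.m j - 1 ≤ A.M j y z := by
          rcases B.ha with h | h
          · rw [h.2.2.1]
            linarith
          · linarith
        have h5 := M_nonneg (A := A) j z y
        rw [rab] at hr ⊢
        exact ⟨by omega, ch_eq_none_of_M (b := y) (by omega)⟩
      by_cases hy : A.slot j y = none <;> by_cases hz : A.slot j z = none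
      · exfalso
        rw [slotVal_none hy, slotVal_none hz] at hv
        have h1 : (ρ.den : ℤ) ∣ A.m j := Rat.den_dvd_of_eq_mul (w := 2) (by push_cast; linarith)
        have h2 := Int.le_of_dvd (A.m_pos j) h1
        have h3 := ρ.den_pos
        have B := nodeBounds hA hyz hsy.symm hsz.symm j
        have h4 := B.one_occupied_pos (by omega) hr
          (by rw [← D_eq hyz hsy.symm hsz.symm]; exact hD) (childCount_cases j s)
        rw [chi_eq hyz hsy.symm hsz.symm, T_one hyz hsy.symm hsz.symm hy hz hs', if_pos hy,
          if_pos hz, if_neg hs', D_eq hyz hsy.symm hsz.symm, rab, rab] at hchi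
        linarith
      · obtain ⟨h1, h2⟩ := key hsy hsz hyz hr hy hz
        exact ⟨h1, Or.inl ⟨hy, h2⟩⟩
      · rw [rab_comm] at hr ⊢
        obtain ⟨h1, h2⟩ := key hsz hsy hyz.symm hr hz hy
        exact ⟨h1, Or.inr ⟨hz, h2⟩⟩
      · exfalso
        rw [chi_eq hsy hsz hyz, T_two hsy hsz hyz hy hz, if_neg hs', if_neg hy, if_neg hz] at hchi
        linarith

theorem exists_last {x y z : Fin 3} (hxy : x ≠ y) (hxz : x ≠ z) (hyz : y ≠ z) (n : Fin r)
    (h : A.slotVal ρ n x + A.slotVal ρ n y = 0) :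
    ∃ l, A.Desc {z} n l ∧ A.ch l z = none ∧ A.val ρ l = A.val ρ n - ρ * A.M n z z := by
  induction n using ch_induction (C := A.toToricConstellation) with
  | h n ih =>
    cases hn : A.ch n z with
    | none => exact ⟨n, Desc.refl n, hn, by simp [M_none hn]⟩
    | some k =>
      obtain ⟨l, h1, h2, h3⟩ := ih z k hn
        (by rw [slotVal_ch_of_ne hn hxz, slotVal_ch_of_ne hn hyz, h])
      refine ⟨l, h1.head hn (mem_singleton_self z), h2, ?_⟩
      rw [h3, val_eq hxy hxz hyz k, slotVal_ch_self hn, slotVal_ch_of_ne hn hxz,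
        slotVal_ch_of_ne hn hyz, h, M_some hn]
      push_cast
      ring

/-- Three good nodes which are pairwise proximate do not occur at the end of a chain. -/
theorem ch_ne_none_of_val (hA : A.Idealistic) (hρ : ρ.den ≠ 1)
    (hS : ∑ k with (ρ.den : ℤ) ∣ A.N k, A.chi k = 0) (k : Fin r) {x y z : Fin 3} (hxy : x ≠ y)
    (hxz : x ≠ z) (hyz : y ≠ z) {i j : Fin r} (hx : A.slot k x = some i) (hy : A.slot k y = some j)
    (hi : A.val ρ i = 0) (hj : A.val ρ j = 0) (hk : A.val ρ k = 0) : A.ch k z ≠ none := by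
  induction k using WellFoundedGT.induction generalizing i j with
  | ind k ih =>
    intro hz
    have hv := val_eq (ρ := ρ) (A := A) hxy hxz hyz k
    rw [hk, slotVal_some hx, hi, slotVal_some hy, hj] at hv
    have hr : 0 ≤ A.rab k y z := by
      have := hA k y z hyz
      rw [rab]
      linarith
    rcases hr.eq_or_lt with hr | hr
    · rw [rab, M_none hz] at hr
      cases hn : A.ch k y with
      | none =>
        rw [M_none hn] at hr
        linarith [A.m_pos k]
      | some n =>
        have hnx : A.slot n x = some i := by rw [slot_ch_of_ne hn hxy, hx]
        have hny := slot_ch_self hn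
        obtain ⟨l, h1, h2, h3⟩ := exists_last (ρ := ρ) hxy hxz hyz n
          (by rw [slotVal_some hnx, slotVal_some hny, hi, hk, add_zero])
        refine ih l (lt_of_lt_of_le (lt_of_ch hn) h1.le) (i := i) (j := k) ?_ ?_ hi hk ?_ h2
        · rw [h1.slot_of_notMem (by simpa using hxz), hnx]
        · rw [h1.slot_of_notMem (by simpa using hyz), hny]
        · rw [M_some hn] at hr
          have hr' : (A.m k : ℚ) = A.m n + A.M n z z := by exact_mod_cast (by linarith)
          rw [h3, val_eq hxy hxz hyz n, slotVal_some hnx, hi, slotVal_some hny, hk,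
            slotVal_ch_of_ne hn hyz.symm]
          rw [hr'] at hv
          linarith
    · obtain ⟨h1, ⟨h2, -⟩ | ⟨h2, h3⟩⟩ := rab_eq_one hA hρ hS hxy hxz hyz k i hx hi hk hr
      · simp [hy] at h2
      · rw [rab, M_none h3, M_none hz] at h1
        have h4 : (A.m k : ℚ) = 1 := by exact_mod_cast (by linarith)
        rw [slotVal_none h2, h4] at hv
        exact hρ (by rw [show ρ = 1 by linarith]; rfl)

end ToricCluster

namespace ToricCluster

open ToricConstellation

variable {r : ℕ} {A : ToricCluster r}

/-! ### The coefficient of a good pair -/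

theorem chitriple_comm (i j k : Fin r) : A.chitriple i j k = A.chitriple i k j := by
  simp only [chitriple, and_comm]

theorem chitriple_eq {i j k : Fin r} {x y z : Fin 3} (hxy : x ≠ y) (hxz : x ≠ z) (hyz : y ≠ z)
    (hx : A.slot k x = some i) (hy : A.slot k y = some j) :
    A.chitriple i j k = 1 - A.childCount k z := by
  classical
  rw [chitriple, card_children _ k (fun w => w = z) ?_, Fin3.sum_eq hxy hxz hyz, if_neg hxz,
    if_neg hyz, if_pos rfl, zero_add, zero_add]
  intro l
  simp only [mem_filter, mem_univ, true_and, prox_iff]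
  constructor
  · rintro ⟨⟨a, ha⟩, ⟨b, hb⟩, c, hc⟩
    obtain ⟨n, hn, hd⟩ := slot_eq_some_iff.1 hc
    have hkn := lt_of_ch hn
    have hne : ∀ {w i' w'}, A.slot k w = some i' → A.slot l w' = some i' → w' ≠ c := by
      rintro w i' w' h h' rfl
      rw [hc] at h'
      cases h'
      exact lt_irrefl _ (slot_lt h)
    have key : ∀ {w i' w'}, A.slot k w = some i' → A.slot l w' = some i' → w' = w := by
      intro w i' w' h h'
      have h1 := (hd.slot_eq h' ((slot_lt h).trans hkn)).1
      rw [slot_ch_of_ne hn (hne h h')] at h1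
      exact slot_injective h1 h
    obtain rfl := key hx ha
    obtain rfl := key hy hb
    have hcz : c = z := by
      rcases Fin3.eq_or hxy hxz hyz c with h | h | h
      · exact absurd h.symm (hne hx ha)
      · exact absurd h.symm (hne hy hb)
      · exact h
    subst hcz
    refine ⟨c, ?_, rfl⟩
    rcases desc_iff_head.1 hd with rfl | ⟨w, hw, q, hq, hql⟩
    · exact hn
    · exfalso
      have key' : ∀ {w i'}, A.slot l w = some i' → i' < n → A.ch n w = some q → False := by
        intro w i' h hlt hq
        have h1 := (hql.slot_eq h (hlt.trans (lt_of_ch hq))).1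
        rw [slot_ch_self hq] at h1
        cases h1
        exact lt_irrefl _ hlt
      rcases Fin3.eq_or hxy hxz hyz w with rfl | rfl | rfl
      · exact key' ha ((slot_lt hx).trans hkn) hq
      · exact key' hb ((slot_lt hy).trans hkn) hq
      · simp at hw
  · rintro ⟨w, hl, rfl⟩
    exact ⟨⟨x, by rw [slot_ch_of_ne hl hxz, hx]⟩, ⟨y, by rw [slot_ch_of_ne hl hyz, hy]⟩,
      w, slot_ch_self hl⟩

theorem prox_prox_iff {i j k : Fin r} {s y z : Fin 3} (hsy : s ≠ y) (hsz : s ≠ z) (hyz : y ≠ z)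
    (hs : A.slot j s = some i) :
    A.Prox k i ∧ A.Prox k j ↔ A.Prox k i ∧ A.LinProx k j := by
  rw [linProx_iff hsy hsz hyz hs]
  constructor
  · rintro ⟨hi, hj⟩
    obtain ⟨t, ht⟩ := prox_iff.1 hi
    obtain ⟨u, hu⟩ := prox_iff.1 hj
    obtain ⟨n, hn, hd⟩ := slot_eq_some_iff.1 hu
    have hij := slot_lt hs
    obtain ⟨h1, h2⟩ := hd.slot_eq ht (hij.trans (lt_of_ch hn))
    have htu : t ≠ u := by
      rintro rfl
      rw [hu] at ht
      cases ht
      exact lt_irrefl _ hij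
    rw [slot_ch_of_ne hn htu] at h1
    obtain rfl := slot_injective h1 hs
    have key : ∀ {u v : Fin 3}, t ≠ u → t ≠ v → u ≠ v → A.ch j u = some n → A.Desc {u}ᶜ n k →
        A.Desc {v} n k := by
      intro u v htu htv huv hn hd
      revert ht
      refine hd.induction (P := fun k => A.slot k t = some i → A.Desc {v} n k)
        (fun _ => Desc.refl n) ?_
      intro p x l hx hl hnp ih hlt
      rcases Fin3.eq_or htu htv huv x with rfl | rfl | rfl
      · rw [slot_ch_self hl] at hlt
        cases hlt
        exact absurd (hij.trans (lt_of_ch hn)) (not_lt.2 hnp.le)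
      · simp at hx
      · rw [slot_ch_of_ne hl htv] at hlt
        exact (ih hlt).tail hl (mem_singleton_self _)
    rcases Fin3.eq_or hsy hsz hyz u with rfl | rfl | rfl
    · exact absurd rfl htu
    · exact Or.inl ⟨n, hn, key hsy hsz hyz hn hd⟩
    · exact Or.inr ⟨n, hn, key hsz hsy hyz.symm hn hd⟩
  · intro h
    have h' := (linProx_iff hsy hsz hyz hs).2 h
    refine ⟨h'.1, prox_iff.2 ?_⟩
    rcases h with ⟨l, hl, hd⟩ | ⟨l, hl, hd⟩
    · exact ⟨y, by rw [hd.slot_of_notMem (by simpa using hyz), slot_ch_self hl]⟩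
    · exact ⟨z, by rw [hd.slot_of_notMem (by simpa using hyz.symm), slot_ch_self hl]⟩

theorem sum_Bpair {M : Type*} [AddCommGroup M] (g : Fin r → M) {i j : Fin r} {s y z : Fin 3}
    (hsy : s ≠ y) (hsz : s ≠ z) (hyz : y ≠ z) (hs : A.slot j s = some i) :
    ∑ k ∈ A.Bpair i j, g k = (A.slot j y).elim 0 g + (A.slot j z).elim 0 g := by
  have h : A.Bpair i j = (A.Bset j).erase i := by
    ext k
    simp [Bpair, Bset]
  have h1 := add_sum_erase (A.Bset j) g (a := i) (by simpa [Bset] using prox_iff.2 ⟨s, hs⟩)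
  rw [sum_Bset, Fin3.sum_eq hsy hsz hyz, hs, Option.elim_some, add_assoc] at h1
  rw [h]
  exact add_left_cancel h1

theorem chipair_eq {i j : Fin r} {s y z : Fin 3} (hsy : s ≠ y) (hsz : s ≠ z) (hyz : y ≠ z)
    (hs : A.slot j s = some i) :
    A.chipair i j = - A.rab j y z
      + (1 - A.childCount j y) * (if A.slot j z = none then 1 else 0)
      + (1 - A.childCount j z) * (if A.slot j y = none then 1 else 0) := by
  classical
  have hij := slot_lt hs
  have hchs : ∀ {k x}, A.ch j x = some k → (A.Prox k i ↔ x ≠ s) := by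
    intro k x hk
    rw [prox_iff]
    constructor
    · rintro ⟨t, ht⟩ rfl
      rcases eq_or_ne t x with rfl | htx
      · rw [slot_ch_self hk] at ht
        cases ht
        exact lt_irrefl _ hij
      · rw [slot_ch_of_ne hk htx] at ht
        exact htx (slot_injective ht hs)
    · intro hx
      exact ⟨s, by rw [slot_ch_of_ne hk hx.symm, hs]⟩
  have hA : ((A.Apair i j).card : ℤ) = A.childCount j y + A.childCount j z := by
    rw [card_children _ j (fun x => x ≠ s) ?_, Fin3.sum_eq hsy hsz hyz, if_neg (by simp),
      if_pos hsy.symm, if_pos hsz.symm, zero_add]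
    intro k
    simp only [Apair, mem_filter, mem_univ, true_and, isChild_iff]
    constructor
    · rintro ⟨⟨x, hx⟩, hk⟩
      exact ⟨x, hx, (hchs hx).1 hk⟩
    · rintro ⟨x, hx, hxs⟩
      exact ⟨⟨x, hx⟩, (hchs hx).2 hxs⟩
  have hB : ((A.Bpair i j).card : ℤ) =
      (if A.slot j y = none then 0 else 1) + (if A.slot j z = none then 0 else 1) := by
    rw [card_eq_sum_ones, Nat.cast_sum, Nat.cast_one, sum_Bpair _ hsy hsz hyz hs]
    cases A.slot j y <;> cases A.slot j z <;> simp
  have hC : ((A.Cpair i j).card : ℤ) =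
      (if A.slot j z = none then 0 else A.childCount j y)
        + (if A.slot j y = none then 0 else A.childCount j z) := by
    have hl : ∀ {k x}, A.ch j x = some k → x ≠ s →
        ((∃ l, l ≠ i ∧ A.Prox k l ∧ A.Prox j l) ↔ ∃ w, w ≠ s ∧ w ≠ x ∧ A.slot j w ≠ none) := by
      intro k x hk hx
      constructor
      · rintro ⟨l, hl, hkl, hjl⟩
        obtain ⟨w, hw⟩ := prox_iff.1 hjl
        refine ⟨w, ?_, ?_, by simp [hw]⟩
        · rintro rfl
          rw [hs] at hw
          cases hw
          exact hl rfl
        · rintro rfl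
          obtain ⟨t, ht⟩ := prox_iff.1 hkl
          rcases eq_or_ne t w with rfl | htw
          · rw [slot_ch_self hk] at ht
            cases ht
            exact lt_irrefl _ (slot_lt hw)
          · rw [slot_ch_of_ne hk htw] at ht
            exact htw (slot_injective ht hw)
      · rintro ⟨w, hws, hwx, hw⟩
        obtain ⟨l, hl⟩ := Option.ne_none_iff_exists'.1 hw
        refine ⟨l, ?_, prox_iff.2 ⟨w, by rw [slot_ch_of_ne hk hwx, hl]⟩, prox_iff.2 ⟨w, hl⟩⟩
        rintro rfl
        exact hws (slot_injective hl hs)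
    have hw : ∀ {u v : Fin 3}, s ≠ u → s ≠ v → u ≠ v →
        ((∃ w, w ≠ s ∧ w ≠ u ∧ A.slot j w ≠ none) ↔ A.slot j v ≠ none) := by
      intro u v hsu hsv huv
      constructor
      · rintro ⟨w, hws, hwu, hw⟩
        rcases Fin3.eq_or hsu hsv huv w with rfl | rfl | rfl
        · exact absurd rfl hws
        · exact absurd rfl hwu
        · exact hw
      · exact fun h => ⟨v, hsv.symm, huv.symm, h⟩
    rw [card_children (A := A) _ j (fun x => x ≠ s ∧ ∃ w, w ≠ s ∧ w ≠ x ∧ A.slot j w ≠ none) ?_,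
      Fin3.sum_eq hsy hsz hyz]
    · simp only [hw hsy hsz hyz, hw hsz hsy hyz.symm]
      simp [hsy.symm, hsz.symm]
    · intro k
      simp only [Cpair, mem_filter, mem_univ, true_and, isChild_iff]
      constructor
      · rintro ⟨⟨x, hx⟩, hk, h⟩
        have hxs := (hchs hx).1 hk
        exact ⟨x, hx, hxs, (hl hx hxs).1 h⟩
      · rintro ⟨x, hx, hxs, h⟩
        exact ⟨⟨x, hx⟩, (hchs hx).2 hxs, (hl hx hxs).2 h⟩
  rw [chipair, chi0pair_eq hsy hsz hyz hs, hA, hB, hC]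
  split_ifs <;> ring

variable {ρ : ℚ}

theorem descSum_last {x y z : Fin 3} (hxy : x ≠ y) (hxz : x ≠ z) (hyz : y ≠ z) (n : Fin r)
    (h : A.slotVal ρ n x + A.slotVal ρ n y = 0) :
    A.descSum {z} (fun k => (1 - (A.childCount k z : ℚ)) * (A.val ρ k)⁻¹) (some n) =
      (A.val ρ n - ρ * A.M n z z)⁻¹ := by
  induction n using ch_induction (C := A.toToricConstellation) with
  | h n ih =>
    rw [descSum_some, sum_singleton]
    cases hn : A.ch n z with
    | none => simp [childCount, hn, M_none hn, descSum_none]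
    | some k =>
      rw [ih z k hn (by rw [slotVal_ch_of_ne hn hxz, slotVal_ch_of_ne hn hyz, h]),
        val_eq hxy hxz hyz k, slotVal_ch_self hn, slotVal_ch_of_ne hn hxz,
        slotVal_ch_of_ne hn hyz, h, M_some hn]
      simp only [childCount, hn, Option.elim_some]
      push_cast
      ring_nf

theorem side_sum {s y z : Fin 3} (hsy : s ≠ y) (hsz : s ≠ z) (hyz : y ≠ z) {i j : Fin r}
    (hs : A.slot j s = some i) (hi : A.val ρ i = 0) (hj : A.val ρ j = 0) :
    (1 - (A.childCount j y : ℚ)) * (if A.slot j z = none then 1 else 0)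
      + A.descSum {z} (fun k => (A.chitriple i j k : ℚ) * (A.val ρ k)⁻¹) (A.ch j y)
      + (A.slot j z).elim 0 (fun k => (A.chitriple i j k : ℚ) * (A.val ρ k)⁻¹) =
    (A.slotVal ρ j z - ρ * A.M j y z)⁻¹ := by
  cases hn : A.ch j y with
  | none =>
    have hc : A.childCount j y = 0 := by simp [childCount, hn]
    rw [descSum_none, M_none hn, hc]
    cases hz : A.slot j z with
    | none => simp [slotVal_none hz]
    | some k =>
      rw [Option.elim_some, chitriple_comm, chitriple_eq hsz hsy hyz.symm hs hz, hc,
        slotVal_some hz]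
      simp
  | some n =>
    have hc : A.childCount j y = 1 := by simp [childCount, hn]
    have hns : A.slot n s = some i := by rw [slot_ch_of_ne hn hsy, hs]
    have hny := slot_ch_self hn
    have h1 : A.descSum {z} (fun k => (A.chitriple i j k : ℚ) * (A.val ρ k)⁻¹) (some n) =
        A.descSum {z} (fun k => (1 - (A.childCount k z : ℚ)) * (A.val ρ k)⁻¹) (some n) := by
      classical
      rw [descSum, descSum]
      refine sum_congr rfl fun k hk => ?_
      have hd := (mem_filter.1 hk).2
      rw [chitriple_eq hsy hsz hyz (by rw [hd.slot_of_notMem (by simpa using hsz), hns])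
        (by rw [hd.slot_of_notMem (by simpa using hyz), hny])]
      push_cast
      rfl
    rw [h1, descSum_last hsy hsz hyz n (by rw [slotVal_some hns, slotVal_some hny, hi, hj, add_zero]),
      val_eq hsy hsz hyz n, slotVal_some hns, slotVal_some hny, hi, hj,
      slotVal_ch_of_ne hn hyz.symm, hc, M_some hn]
    cases hz : A.slot j z with
    | none =>
      simp
      ring_nf
    | some k =>
      rw [Option.elim_some, chitriple_comm, chitriple_eq hsz hsy hyz.symm hs hz, hc]
      simp
      ring_nf

/-- The contributions of a good pair to the coefficient of the double pole cancel. -/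
theorem pair_coeff (hA : A.Idealistic) (hρ : ρ.den ≠ 1)
    (hS : ∑ k with (ρ.den : ℤ) ∣ A.N k, A.chi k = 0) {i j : Fin r} (hij : A.Prox j i)
    (hi : A.val ρ i = 0) (hj : A.val ρ j = 0) :
    (A.chipair i j : ℚ) + A.chi0pair i j * (1 - ρ)⁻¹
      + ∑ k with A.Prox k i ∧ A.Prox k j, (A.chitriple i j k : ℚ) * (A.val ρ k)⁻¹
      + ∑ k ∈ A.Bpair i j, (A.chitriple i j k : ℚ) * (A.val ρ k)⁻¹ = 0 := by
  obtain ⟨s, hs⟩ := prox_iff.1 hij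
  obtain ⟨y, z, hsy, hsz, hyz⟩ := Fin3.exists_others s
  simp only [prox_prox_iff hsy hsz hyz hs]
  rw [sum_linProx _ hsy hsz hyz hs, sum_Bpair _ hsy hsz hyz hs, chi0pair_eq hsy hsz hyz hs,
    chipair_eq hsy hsz hyz hs]
  have h1 := side_sum hsy hsz hyz hs hi hj
  have h2 := side_sum hsz hsy hyz.symm hs hi hj
  set α := A.slotVal ρ j z - ρ * A.M j y z with hα
  set β := A.slotVal ρ j y - ρ * A.M j z y with hβ
  have hρ1 : ρ ≠ 1 := by
    rintro rfl
    exact hρ rfl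
  have hv := val_eq (ρ := ρ) (A := A) hsy hsz hyz j
  rw [hj, slotVal_some hs, hi] at hv
  have key : -(A.rab j y z : ℚ) + A.rab j y z * (1 - ρ)⁻¹ + α⁻¹ + β⁻¹ = 0 := by
    have hr : 0 ≤ A.rab j y z := by
      have := hA j y z hyz
      rw [rab]
      linarith
    rcases hr.eq_or_lt with hr | hr
    · have h3 : α = -β := by
        have h4 : (A.m j : ℚ) - A.M j y z - A.M j z y = 0 := by
          rw [rab] at hr
          exact_mod_cast hr.symm
        rw [hα, hβ]
        linear_combination -hv + ρ * h4
      rw [← hr, h3, inv_neg]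
      simp
    · obtain ⟨h3, h4⟩ := rab_eq_one hA hρ hS hsy hsz hyz j i hs hi hj hr
      have h5 : (A.m j : ℚ) - A.M j y z - A.M j z y = 1 := by
        rw [rab] at h3
        exact_mod_cast h3
      have h6 : 1 - ρ ≠ 0 := sub_ne_zero.2 hρ1.symm
      have h7 : α + β = ρ := by
        rw [hα, hβ]
        linear_combination -hv + ρ * h5
      have h8 : α⁻¹ + β⁻¹ = 1 - (1 - ρ)⁻¹ := by
        rcases h4 with ⟨h9, h10⟩ | ⟨h9, h10⟩
        · have h11 : β = 1 := by rw [hβ, slotVal_none h9, M_none h10]; simp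
          rw [h11, show α = -(1 - ρ) by linarith, inv_neg]
          ring
        · have h11 : α = 1 := by rw [hα, slotVal_none h9, M_none h10]; simp
          rw [h11, show β = -(1 - ρ) by linarith, inv_neg]
          ring
      rw [h3]
      push_cast
      linear_combination h8
  push_cast
  linear_combination key + h1 + h2

end ToricCluster

open Polynomial in
/-- The rational function `F` is regular at `s` with value `c`. -/
def RatFunc.HasValue {K : Type*} [Field K] (s : K) (F : RatFunc K) (c : K) : Prop :=
  ∃ p q : K[X], q.eval s ≠ 0 ∧ F * algebraMap K[X] (RatFunc K) q = algebraMap K[X] (RatFunc K) p ∧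
    p.eval s = c * q.eval s

namespace RatFunc.HasValue

open Polynomial

variable {K : Type*} [Field K] {s : K} {F G : RatFunc K} {c d : K}

theorem of_polynomial (p : K[X]) : HasValue s (algebraMap K[X] (RatFunc K) p) (p.eval s) :=
  ⟨p, 1, by simp, by simp, by simp⟩

theorem intCast (n : ℤ) : HasValue s (n : RatFunc K) (n : K) := by
  simpa using of_polynomial (s := s) (n : K[X])

theorem X_add_C (a : K) : HasValue s (RatFunc.X + RatFunc.C a) (s + a) := by
  have h := of_polynomial (s := s) (Polynomial.X + Polynomial.C a)
  rwa [_root_.map_add, RatFunc.algebraMap_X, RatFunc.algebraMap_C, Polynomial.eval_add,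
    Polynomial.eval_X, Polynomial.eval_C] at h

theorem add (hF : HasValue s F c) (hG : HasValue s G d) : HasValue s (F + G) (c + d) := by
  obtain ⟨p, q, hq, h, hv⟩ := hF
  obtain ⟨p', q', hq', h', hv'⟩ := hG
  refine ⟨p * q' + p' * q, q * q', by simp [hq, hq'], ?_, ?_⟩
  · simp only [_root_.map_add, _root_.map_mul, ← h, ← h']
    ring
  · simp only [Polynomial.eval_add, Polynomial.eval_mul, hv, hv']
    ring

theorem mul (hF : HasValue s F c) (hG : HasValue s G d) : HasValue s (F * G) (c * d) := by
  obtain ⟨p, q, hq, h, hv⟩ := hF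
  obtain ⟨p', q', hq', h', hv'⟩ := hG
  refine ⟨p * p', q * q', by simp [hq, hq'], ?_, ?_⟩
  · simp only [_root_.map_mul, ← h, ← h']
    ring
  · simp only [Polynomial.eval_mul, hv, hv']
    ring

theorem inv (hF : HasValue s F c) (hc : c ≠ 0) : HasValue s F⁻¹ c⁻¹ := by
  obtain ⟨p, q, hq, h, hv⟩ := hF
  have hp : p.eval s ≠ 0 := by
    rw [hv]
    exact mul_ne_zero hc hq
  have hF0 : F ≠ 0 := by
    rintro rfl
    rw [zero_mul, eq_comm, FaithfulSMul.algebraMap_eq_zero_iff] at h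
    simp [h] at hp
  refine ⟨q, p, hp, ?_, ?_⟩
  · rw [← h, inv_mul_cancel_left₀ hF0]
  · rw [hv, inv_mul_cancel_left₀ hc]

theorem sum {ι : Type*} (t : Finset ι) (f : ι → RatFunc K) (e : ι → K)
    (h : ∀ i ∈ t, HasValue s (f i) (e i)) : HasValue s (∑ i ∈ t, f i) (∑ i ∈ t, e i) := by
  classical
  induction t using Finset.induction_on with
  | empty => simpa using intCast (s := s) 0
  | insert a t ha ih =>
    rw [sum_insert ha, sum_insert ha]
    exact (h a (mem_insert_self a t)).add (ih fun i hi => h i (mem_insert_of_mem hi))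

theorem congr_value (hF : HasValue s F c) (h : c = d) : HasValue s F d := h ▸ hF

/-- If `(X - s) ^ 2 * F` vanishes at `s`, then `F` has at most a simple pole there. -/
theorem rootMultiplicity_denom_lt_two (h : HasValue s ((RatFunc.X + RatFunc.C (-s)) ^ 2 * F) 0) :
    F.denom.rootMultiplicity s < 2 := by
  by_contra! h2
  obtain ⟨p, q, hq, h, hp⟩ := h
  rw [zero_mul] at hp
  obtain ⟨d, hd⟩ := (le_rootMultiplicity_iff F.denom_ne_zero).1 h2
  have hX : (RatFunc.X + RatFunc.C (-s) : RatFunc K) =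
      algebraMap K[X] (RatFunc K) (Polynomial.X - Polynomial.C s) := by
    simp [RatFunc.algebraMap_X, RatFunc.algebraMap_C, sub_eq_add_neg]
  have hden : algebraMap K[X] (RatFunc K) F.denom ≠ 0 := RatFunc.algebraMap_ne_zero F.denom_ne_zero
  have hF : F * algebraMap K[X] (RatFunc K) F.denom = algebraMap K[X] (RatFunc K) F.num := by
    exact ((div_eq_iff hden).1 (RatFunc.num_div_denom F)).symm
  have h1 : (Polynomial.X - Polynomial.C s) ^ 2 * F.num * q = p * F.denom := by
    apply RatFunc.algebraMap_injective K
    rw [map_mul, map_mul, map_mul, map_pow, ← hX, ← hF, ← h]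
    ring
  have h3 : F.num * q = p * d := by
    have h4 : (Polynomial.X - Polynomial.C s) ^ 2 * (F.num * q) =
        (Polynomial.X - Polynomial.C s) ^ 2 * (p * d) := by
      rw [← mul_assoc, h1, hd]
      ring
    exact mul_left_cancel₀ (pow_ne_zero 2 (X_sub_C_ne_zero s)) h4
  have h5 : F.num.eval s = 0 := by
    have h6 := congr_arg (Polynomial.eval s) h3
    rw [Polynomial.eval_mul, Polynomial.eval_mul, hp, zero_mul] at h6
    exact (mul_eq_zero.1 h6).resolve_right hq
  have h7 : F.denom.eval s = 0 := by
    rw [hd]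
    simp
  obtain ⟨u, v, huv⟩ := RatFunc.isCoprime_num_denom F
  have h8 := congr_arg (Polynomial.eval s) huv
  simp [h5, h7] at h8

end RatFunc.HasValue

namespace ToricCluster

open ToricConstellation RatFunc

variable {r : ℕ} {A : ToricCluster r}

/-! ### The order of the candidate pole -/

theorem chitriple_swap (i j k : Fin r) : A.chitriple i j k = A.chitriple j i k := by
  simp only [chitriple, and_left_comm]

theorem prox_of_prox_prox {i j k : Fin r} (hi : A.Prox k i) (hj : A.Prox k j) (h : i < j) :
    A.Prox j i := by
  obtain ⟨a, ha⟩ := prox_iff.1 hi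
  obtain ⟨b, hb⟩ := prox_iff.1 hj
  obtain ⟨n, hn, hd⟩ := slot_eq_some_iff.1 hb
  have h1 := (hd.slot_eq ha (h.trans (lt_of_ch hn))).1
  refine prox_iff.2 ⟨a, ?_⟩
  rwa [slot_ch_of_ne hn] at h1
  rintro rfl
  rw [ha] at hb
  cases hb
  exact lt_irrefl _ h

/-- Summation over triples of pairwise proximate nodes, grouped by pairs. -/
theorem sum_triples (g u : Fin r → ℚ) :
    ∑ t ∈ (univ : Finset (Fin r × Fin r × Fin r)).filter
        (fun t => t.1 < t.2.1 ∧ t.2.1 < t.2.2 ∧ Prox A.toToricConstellation t.2.2 t.1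
          ∧ Prox A.toToricConstellation t.2.2 t.2.1),
      (A.chitriple t.1 t.2.1 t.2.2 : ℚ) * (g t.1 * g t.2.1 * u t.2.2 + g t.1 * u t.2.1 * g t.2.2
        + u t.1 * g t.2.1 * g t.2.2) =
    ∑ p ∈ (univ ×ˢ univ).filter
        (fun p : Fin r × Fin r => Prox A.toToricConstellation p.2 p.1),
      g p.1 * g p.2 * (∑ k with A.Prox k p.1 ∧ A.Prox k p.2, (A.chitriple p.1 p.2 k : ℚ) * u k
        + ∑ k ∈ A.Bpair p.1 p.2, (A.chitriple p.1 p.2 k : ℚ) * u k) := by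
  set f : Fin r → Fin r → Fin r → ℚ := fun i j k =>
    if i < j ∧ A.Prox k i ∧ A.Prox k j then (A.chitriple i j k : ℚ) else 0 with hf
  have h1 : ∀ i j k, (if i < j ∧ j < k ∧ A.Prox k i ∧ A.Prox k j then (A.chitriple i j k : ℚ) *
      (g i * g j * u k + g i * u j * g k + u i * g j * g k) else 0) =
      f i j k * (g i * g j * u k) + f i j k * (g i * u j * g k) + f i j k * (u i * g j * g k) := by
    intro i j k
    simp only [hf]
    by_cases h : i < j ∧ A.Prox k i ∧ A.Prox k j
    · rw [if_pos h, if_pos ⟨h.1, h.2.2.lt, h.2⟩]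
      ring
    · rw [if_neg h, if_neg fun h' => h ⟨h'.1, h'.2.2⟩]
      ring
  rw [univ_product_univ, sum_filter, sum_filter, Fintype.sum_prod_type, Fintype.sum_prod_type]
  simp only [Fintype.sum_prod_type, h1, sum_add_distrib]
  have h2 : ∑ i, ∑ j, ∑ k, f i j k * (g i * u j * g k) =
      ∑ i, ∑ j, ∑ k, f i k j * (g i * u k * g j) :=
    sum_congr rfl fun i _ => sum_comm
  have h3 : ∑ i, ∑ j, ∑ k, f i j k * (u i * g j * g k) =
      ∑ i, ∑ j, ∑ k, f k i j * (u k * g i * g j) := by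
    rw [sum_comm]
    exact sum_congr rfl fun i _ => sum_comm
  rw [h2, h3, ← sum_add_distrib, ← sum_add_distrib]
  refine sum_congr rfl fun i _ => ?_
  rw [← sum_add_distrib, ← sum_add_distrib]
  refine sum_congr rfl fun j _ => ?_
  by_cases hij : A.Prox j i
  · rw [if_pos hij, Bpair, sum_filter, sum_filter, ← sum_add_distrib, ← sum_add_distrib,
      ← sum_add_distrib, mul_sum]
    refine sum_congr rfl fun k _ => ?_
    simp only [hf]
    have hlt := hij.lt
    rcases lt_trichotomy i k with h | rfl | h
    · have hki : ¬ k < i := h.asymm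
      simp only [hlt, h, hij, hki, h.ne', true_and, false_and, ne_eq, not_false_eq_true,
        ↓reduceIte, chitriple_comm (A := A) i k j]
      split_ifs <;> ring
    · have hii : ¬ A.Prox i i := fun h => lt_irrefl _ h.lt
      simp [hii]
    · have hik : ¬ i < k := h.asymm
      have hk : ¬ A.Prox k i := fun h' => hik h'.lt
      simp only [hik, h, hij, hk, h.ne, and_true, true_and, false_and, and_false, ne_eq,
        not_false_eq_true, ↓reduceIte, chitriple_swap (A := A) k i j, chitriple_comm (A := A) i k j]
      split_ifs <;> ring
  · rw [if_neg hij]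
    have hf1 : ∀ k, f i j k = 0 := fun k =>
      if_neg fun h => hij (prox_of_prox_prox h.2.1 h.2.2 h.1)
    have hf2 : ∀ k, f i k j = 0 := fun k => if_neg fun h => hij h.2.1
    have hf3 : ∀ k, f k i j = 0 := fun k => if_neg fun h => hij h.2.2
    simp [hf1, hf2, hf3]

end ToricCluster

namespace ToricCluster

open ToricConstellation RatFunc

variable {r : ℕ} (A : ToricCluster r) (ρ : ℚ)

theorem hasValue_lin (k : Fin r) : HasValue (-ρ) (A.lin k) (A.val ρ k) := by
  have h := ((HasValue.intCast (A.N k)).mul (HasValue.X_add_C (s := -ρ) 0)).add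
    (HasValue.intCast (A.nu k))
  rw [RatFunc.C.map_zero, add_zero, add_zero] at h
  refine h.congr_value ?_
  rw [val]
  ring

/-- The value of `(s + ρ) / (N_k s + ν_k)` at `s = -ρ`. -/
def residue (k : Fin r) : ℚ :=
  if A.val ρ k = 0 then (A.N k : ℚ)⁻¹ else 0

theorem hasValue_residue (k : Fin r) :
    HasValue (-ρ) ((X + C ρ) * (A.lin k)⁻¹) (A.residue ρ k) := by
  rw [residue]
  split_ifs with hk
  · have hN : (A.N k : ℚ) ≠ 0 := by exact_mod_cast (A.N_pos k).ne'
    have hlin : A.lin k = (A.N k : RatFunc ℚ) * (X + C ρ) := by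
      have hnu : (A.nu k : ℚ) = A.N k * ρ := by
        rw [val] at hk
        linarith
      rw [lin, mul_add]
      congr 1
      have h := congr_arg (C : ℚ →+* RatFunc ℚ) hnu
      simpa using h
    have hX : (X + C ρ : RatFunc ℚ) ≠ 0 := by
      intro h
      have h1 := A.N_pos k
      have h2 : algebraMap (Polynomial ℚ) (RatFunc ℚ) (Polynomial.X + Polynomial.C ρ) = 0 := by
        rwa [map_add, algebraMap_X, algebraMap_C]
      exact Polynomial.X_add_C_ne_zero ρ ((FaithfulSMul.algebraMap_eq_zero_iff _ _).1 h2)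
    rw [hlin, mul_inv, mul_left_comm, mul_inv_cancel₀ hX, mul_one]
    exact (HasValue.intCast _).inv hN
  · have h := (HasValue.X_add_C (s := -ρ) ρ).mul ((A.hasValue_lin ρ k).inv hk)
    rwa [neg_add_cancel, zero_mul] at h

variable {A ρ}

theorem residue_of_ne {k : Fin r} (hk : A.val ρ k ≠ 0) : A.residue ρ k = 0 := if_neg hk

theorem hasValue_X_add_C : HasValue (-ρ) (X + C ρ) 0 := by
  have h := HasValue.X_add_C (s := -ρ) ρ
  rwa [neg_add_cancel] at h

theorem hasValue_X_add_one (hρ : ρ ≠ 1) : HasValue (-ρ) (X + 1)⁻¹ (1 - ρ)⁻¹ := by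
  have h := HasValue.X_add_C (s := -ρ) 1
  rw [map_one] at h
  exact (h.congr_value (neg_add_eq_sub ρ 1)).inv (sub_ne_zero.2 hρ.symm)

theorem hasValue_single (hρ : ρ ≠ 1) (i : Fin r) :
    HasValue (-ρ) ((X + C ρ) ^ 2 * ((A.chi i : RatFunc ℚ) / A.lin i
      + (A.chi0 i : RatFunc ℚ) / ((X + 1) * A.lin i))) 0 := by
  have h := hasValue_X_add_C.mul ((A.hasValue_residue ρ i).mul
    ((HasValue.intCast (A.chi i)).add
      ((HasValue.intCast (A.chi0 i)).mul (hasValue_X_add_one hρ))))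
  rw [zero_mul] at h
  convert h using 1
  rw [div_eq_mul_inv, div_eq_mul_inv, mul_inv]
  ring

theorem hasValue_pair (hρ : ρ ≠ 1) (i j : Fin r) :
    HasValue (-ρ) ((X + C ρ) ^ 2 * ((A.chipair i j : RatFunc ℚ) / (A.lin i * A.lin j)
      + (A.chi0pair i j : RatFunc ℚ) / ((X + 1) * (A.lin i * A.lin j))))
      (A.residue ρ i * A.residue ρ j * (A.chipair i j + A.chi0pair i j * (1 - ρ)⁻¹)) := by
  have h := ((A.hasValue_residue ρ i).mul (A.hasValue_residue ρ j)).mul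
    ((HasValue.intCast (A.chipair i j)).add
      ((HasValue.intCast (A.chi0pair i j)).mul (hasValue_X_add_one hρ)))
  convert h using 1
  rw [div_eq_mul_inv, div_eq_mul_inv, mul_inv, mul_inv]
  ring

theorem chitriple_eq_zero (hA : A.Idealistic) (hρ : ρ.den ≠ 1)
    (hS : ∑ k with (ρ.den : ℤ) ∣ A.N k, A.chi k = 0) {i j k : Fin r} (hij : i ≠ j)
    (hki : A.Prox k i) (hkj : A.Prox k j) (hi : A.val ρ i = 0) (hj : A.val ρ j = 0)
    (hk : A.val ρ k = 0) : A.chitriple i j k = 0 := by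
  obtain ⟨x, hx⟩ := prox_iff.1 hki
  obtain ⟨y, hy⟩ := prox_iff.1 hkj
  have hxy : x ≠ y := by
    rintro rfl
    rw [hx] at hy
    exact hij (Option.some_injective _ hy)
  have hz : ∀ x y : Fin 3, ∃ z, x ≠ z ∧ y ≠ z := by decide
  obtain ⟨z, hxz, hyz⟩ := hz x y
  obtain ⟨l, hl⟩ := Option.ne_none_iff_exists'.1
    (ch_ne_none_of_val hA hρ hS k hxy hxz hyz hx hy hi hj hk)
  rw [chitriple_eq hxy hxz hyz hx hy, childCount, hl, Option.elim_some, sub_self]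

theorem hasValue_triple {i j k : Fin r}
    (h0 : A.val ρ i = 0 → A.val ρ j = 0 → A.val ρ k = 0 → A.chitriple i j k = 0) :
    HasValue (-ρ) ((X + C ρ) ^ 2 * ((A.chitriple i j k : RatFunc ℚ) /
      (A.lin i * A.lin j * A.lin k)))
      (A.chitriple i j k * (A.residue ρ i * A.residue ρ j * (A.val ρ k)⁻¹
        + A.residue ρ i * (A.val ρ j)⁻¹ * A.residue ρ k
        + (A.val ρ i)⁻¹ * A.residue ρ j * A.residue ρ k)) := by
  have key : ∀ i j k : Fin r, A.val ρ k ≠ 0 → HasValue (-ρ)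
      ((X + C ρ) ^ 2 * (A.lin i * A.lin j * A.lin k)⁻¹)
      (A.residue ρ i * A.residue ρ j * (A.val ρ k)⁻¹) := by
    intro i j k hk
    have h := ((A.hasValue_residue ρ i).mul (A.hasValue_residue ρ j)).mul
      ((A.hasValue_lin ρ k).inv hk)
    convert h using 1
    rw [mul_inv, mul_inv]
    ring
  rw [div_eq_mul_inv, mul_left_comm]
  by_cases hk : A.val ρ k = 0
  · by_cases hj : A.val ρ j = 0
    · by_cases hi : A.val ρ i = 0
      · simpa [h0 hi hj hk] using HasValue.intCast (s := -ρ) 0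
      · have h := (HasValue.intCast (A.chitriple i j k)).mul (key j k i hi)
        rw [mul_rotate (A.lin i)]
        refine h.congr_value ?_
        rw [residue_of_ne hi]
        ring
    · have h := (HasValue.intCast (A.chitriple i j k)).mul (key i k j hj)
      rw [mul_right_comm (A.lin i)]
      refine h.congr_value ?_
      rw [residue_of_ne hj]
      ring
  · have h := (HasValue.intCast (A.chitriple i j k)).mul (key i j k hk)
    rw [residue_of_ne hk, mul_zero, mul_zero, add_zero, add_zero]
    exact h

/-- A double pole at `-ρ` with `ρ ∉ ℤ` forces the Euler characteristics of the components
with `ρ.den ∣ N` not to cancel. -/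
theorem rootMultiplicity_denom_Zeta_lt_two (hA : A.Idealistic) (hρ : ρ.den ≠ 1)
    (hS : ∑ k with (ρ.den : ℤ) ∣ A.N k, A.chi k = 0) :
    (A.Zeta).denom.rootMultiplicity (-ρ) < 2 := by
  have hρ1 : ρ ≠ 1 := by
    rintro rfl
    exact hρ rfl
  apply HasValue.rootMultiplicity_denom_lt_two
  rw [neg_neg, Zeta, mul_add, mul_add, mul_sum, mul_sum, mul_sum]
  refine (((HasValue.sum _ _ _ fun i _ => hasValue_single hρ1 i).add
    (HasValue.sum _ _ _ fun p _ => hasValue_pair hρ1 p.1 p.2)).add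
    (HasValue.sum _ _ _ fun t ht => hasValue_triple fun hi hj hk => ?_)).congr_value ?_
  · obtain ⟨h1, h2, h3, h4⟩ := (mem_filter.1 ht).2
    exact chitriple_eq_zero hA hρ hS h1.ne h3 h4 hi hj hk
  · rw [sum_triples (A.residue ρ) fun k => (A.val ρ k)⁻¹, sum_const_zero, zero_add,
      ← sum_add_distrib]
    refine sum_eq_zero fun p hp => ?_
    rw [← mul_add]
    by_cases hi : A.val ρ p.1 = 0
    · by_cases hj : A.val ρ p.2 = 0
      · rw [← add_assoc, pair_coeff hA hρ hS (mem_filter.1 hp).2 hi hj, mul_zero]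
      · rw [residue_of_ne hj, mul_zero, zero_mul]
    · rw [residue_of_ne hi, zero_mul, zero_mul]

end ToricCluster

open ToricConstellation ToricCluster

theorem stmt15 {r : ℕ} (A : ToricCluster r) (hA : A.Idealistic) (i j : Fin r)
    (hprox : Prox A.toToricConstellation j i)
    (hchii : A.chi i = 0) (hchij : A.chi j = 0)
    (heq : A.nu i * A.N j = A.nu j * A.N i)
    (a b : ℕ) (ha : 0 < a) (hb : 0 < b) (hab : Nat.Coprime a b)
    (hratio : A.nu i * (b : ℤ) = (a : ℤ) * A.N i)
    (hpole : 2 ≤ (A.Zeta).denom.rootMultiplicity (-(a : ℚ) / (b : ℚ))) :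
    b = 1 ∨ (∑ k ∈ Finset.univ.filter (fun k => (b : ℤ) ∣ A.N k), A.chi k) ≠ 0 := by
  rw [or_iff_not_imp_left]
  intro hb1 hS
  have hden : ((a : ℚ) / b).den = b := by
    have h := Rat.den_div_eq_of_coprime (a := a) (b := b) (by exact_mod_cast hb) (by simpa using hab)
    simpa only [Int.cast_natCast, Nat.cast_inj] using h
  rw [neg_div] at hpole
  refine hpole.not_gt (rootMultiplicity_denom_Zeta_lt_two hA ?_ ?_)
  · rwa [hden]
  · rwa [hden]
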